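/- arXiv:2312.05931 — 6 statements merged into one kernel-verified Lean document; each statement's English description precedes it below -/
import Mathlib

section
/- Let f : ℝ² → ℝ³ be C^∞ on a neighborhood of the origin with f(0,0) = 0, and suppose there are C^∞ maps φ₁, φ₂ : ℝ² → ℝ³ such that ∂f/∂u(u,v) = u·φ₁(u,v) and ∂f/∂v(u,v) = v·φ₂(u,v) near the origin, and φ₁(0,0), φ₂(0,0) are linearly independent. Then there exist a real number a ≥ 0, C^∞ functions b₁, b₃, c₁, c₃ : ℝ → ℝ with c₁(0) ≥ 0 and c₃(0) ≥ 0, C^∞ functions b₂, c₂ : ℝ² → ℝ, open neighborhoods U, V of the origin in ℝ², a C^∞ diffeomorphism s : U → V with s(0,0) = (0,0) and det(Ds) > 0 on U, and a matrix A ∈ SO(3), such that for all (u,v) ∈ V: A·f(s⁻¹(u,v)) = (u² − v², a(u² + v²) + u³b₁(u) + u²v²b₂(u,v) + v³b₃(v), u³c₁(u) + u²v²c₂(u,v) + v³c₃(v)). -/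
open Real Filter Topology

noncomputable section

/-- Euclidean inner product on `ℝ³` (realized as `Fin 3 → ℝ`). -/
def dot3 (x y : Fin 3 → ℝ) : ℝ := x 0 * y 0 + x 1 * y 1 + x 2 * y 2

/-- Euclidean norm on `ℝ³`. -/
def norm3 (x : Fin 3 → ℝ) : ℝ := Real.sqrt (dot3 x x)

/-- Cross product on `ℝ³`. -/
def cross3 (x y : Fin 3 → ℝ) : Fin 3 → ℝ :=
  ![x 1 * y 2 - x 2 * y 1, x 2 * y 0 - x 0 * y 2, x 0 * y 1 - x 1 * y 0]

/-- Determinant of the `3 × 3` matrix whose columns are `x`, `y`, `z`. -/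
def det3 (x y z : Fin 3 → ℝ) : ℝ := Matrix.det (Matrix.of ![x, y, z]).transpose

/-- Partial derivative with respect to the first variable. -/
def pd1 {E : Type*} [NormedAddCommGroup E] [NormedSpace ℝ E]
    (g : ℝ × ℝ → E) (p : ℝ × ℝ) : E := deriv (fun u => g (u, p.2)) p.1

/-- Partial derivative with respect to the second variable. -/
def pd2 {E : Type*} [NormedAddCommGroup E] [NormedSpace ℝ E]
    (g : ℝ × ℝ → E) (p : ℝ × ℝ) : E := deriv (fun v => g (p.1, v)) p.2

/-- The building block `u³·g₁(u) + u²v²·g₂(u,v) + v³·g₃(v)`. -/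
def BC (g1 g3 : ℝ → ℝ) (g2 : ℝ × ℝ → ℝ) (p : ℝ × ℝ) : ℝ :=
  p.1 ^ 3 * g1 p.1 + p.1 ^ 2 * p.2 ^ 2 * g2 p + p.2 ^ 3 * g3 p.2

/-- The D₄⁺ normal form
`f(u,v) = (u² − v², a(u² + v²) + b(u,v), c(u,v))`. -/
def NF (a : ℝ) (b1 b3 c1 c3 : ℝ → ℝ) (b2 c2 : ℝ × ℝ → ℝ) (p : ℝ × ℝ) : Fin 3 → ℝ :=
  ![p.1 ^ 2 - p.2 ^ 2, a * (p.1 ^ 2 + p.2 ^ 2) + BC b1 b3 b2 p, BC c1 c3 c2 p]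

/-- The vector field `φ₁` with `∂f/∂u = u·φ₁`. -/
def Phi1 (a : ℝ) (b1 c1 : ℝ → ℝ) (b2 c2 : ℝ × ℝ → ℝ) (p : ℝ × ℝ) : Fin 3 → ℝ :=
  ![2, 2 * a + 3 * p.1 * b1 p.1 + p.1 ^ 2 * deriv b1 p.1 + 2 * p.2 ^ 2 * b2 p +
      p.1 * p.2 ^ 2 * pd1 b2 p,
    3 * p.1 * c1 p.1 + p.1 ^ 2 * deriv c1 p.1 + 2 * p.2 ^ 2 * c2 p +
      p.1 * p.2 ^ 2 * pd1 c2 p]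

/-- The vector field `φ₂` with `∂f/∂v = v·φ₂`. -/
def Phi2 (a : ℝ) (b3 c3 : ℝ → ℝ) (b2 c2 : ℝ × ℝ → ℝ) (p : ℝ × ℝ) : Fin 3 → ℝ :=
  ![-2, 2 * a + 3 * p.2 * b3 p.2 + p.2 ^ 2 * deriv b3 p.2 + 2 * p.1 ^ 2 * b2 p +
      p.1 ^ 2 * p.2 * pd2 b2 p,
    3 * p.2 * c3 p.2 + p.2 ^ 2 * deriv c3 p.2 + 2 * p.1 ^ 2 * c2 p +
      p.1 ^ 2 * p.2 * pd2 c2 p]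

/-- The unit normal `ν = (φ₁ × φ₂)/‖φ₁ × φ₂‖` of the D₄⁺ normal form. -/
def nuNF (a : ℝ) (b1 b3 c1 c3 : ℝ → ℝ) (b2 c2 : ℝ × ℝ → ℝ) (p : ℝ × ℝ) : Fin 3 → ℝ :=
  (norm3 (cross3 (Phi1 a b1 c1 b2 c2 p) (Phi2 a b3 c3 b2 c2 p)))⁻¹ •
    cross3 (Phi1 a b1 c1 b2 c2 p) (Phi2 a b3 c3 b2 c2 p)

/-- The distance squared function `d_x(u,v) = ‖x − f(u,v)‖²/2`. -/
def dsq (f : ℝ × ℝ → Fin 3 → ℝ) (x : Fin 3 → ℝ) (p : ℝ × ℝ) : ℝ :=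
  dot3 (x - f p) (x - f p) / 2

theorem had_param_aux (n : ℕ) : ∀ (E : Type) [NormedAddCommGroup E] [NormedSpace ℝ E] [CompleteSpace E]
    (F : (ℝ × ℝ) × ℝ → E), ContDiff ℝ (⊤ : ℕ∞) F →
    ContDiff ℝ n (fun p : ℝ × ℝ => ∫ t in (0:ℝ)..1, F (p, t)) := by
  induction n with
  | zero =>
    intro E _ _ _ F hF
    rw [Nat.cast_zero, contDiff_zero]
    exact intervalIntegral.continuous_parametric_intervalIntegral_of_continuous' (f := fun p t => F (p, t)) hF.continuous 0 1
  | succ n ih =>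
    intro E _ _ _ F hF
    set F' : (ℝ × ℝ) × ℝ → (ℝ × ℝ →L[ℝ] E) :=
      fun x => (fderiv ℝ F x).comp (ContinuousLinearMap.inl ℝ (ℝ × ℝ) ℝ) with hF'def
    have hF' : ContDiff ℝ (⊤ : ℕ∞) F' := by
      have h1 : ContDiff ℝ (⊤ : ℕ∞) (fderiv ℝ F) := hF.fderiv_right (by simp)
      exact h1.clm_comp contDiff_const
    have hpart : ∀ p t, HasFDerivAt (fun p => F (p, t)) (F' (p, t)) p := by
      intro p t
      have h1 : HasFDerivAt F (fderiv ℝ F (p, t)) (p, t) :=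
        (hF.differentiable (by simp) _).hasFDerivAt
      exact h1.comp p (hasFDerivAt_prodMk_left p t)
    have hder : ∀ p, HasFDerivAt (fun p : ℝ × ℝ => ∫ t in (0:ℝ)..1, F (p, t))
        (∫ t in (0:ℝ)..1, F' (p, t)) p := by
      intro p
      have hK : IsCompact (Metric.closedBall p 1 ×ˢ Set.Icc (0:ℝ) 1) :=
        (isCompact_closedBall p 1).prod isCompact_Icc
      obtain ⟨C, hC⟩ := hK.exists_bound_of_continuousOn hF'.continuous.continuousOn
      refine intervalIntegral.hasFDerivAt_integral_of_dominated_of_fderiv_le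
        (F := fun p t => F (p, t)) (F' := fun p t => F' (p, t)) (bound := fun _ => C)
        (s := Metric.closedBall p 1)
        (Metric.closedBall_mem_nhds p one_pos) ?_ ?_ ?_ ?_ ?_ ?_
      · refine Filter.Eventually.of_forall fun x => ?_
        exact (hF.continuous.comp (Continuous.prodMk_right x)).aestronglyMeasurable
      · exact (hF.continuous.comp (Continuous.prodMk_right p)).intervalIntegrable _ _
      · exact (hF'.continuous.comp (Continuous.prodMk_right p)).aestronglyMeasurable
      · refine Filter.Eventually.of_forall fun t ht x hx => ?_
        refine hC (x, t) ⟨hx, ?_⟩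
        rw [Set.uIoc_of_le zero_le_one] at ht
        exact ⟨ht.1.le, ht.2⟩
      · exact intervalIntegrable_const
      · exact Filter.Eventually.of_forall fun t _ x _ => hpart x t
    push_cast
    rw [contDiff_succ_iff_fderiv]
    refine ⟨fun p => (hder p).differentiableAt, by simp, ?_⟩
    have : fderiv ℝ (fun p : ℝ × ℝ => ∫ t in (0:ℝ)..1, F (p, t)) =
        fun p => ∫ t in (0:ℝ)..1, F' (p, t) := funext fun p => (hder p).fderiv
    rw [this]
    exact ih _ F' hF'

theorem had_param (F : (ℝ × ℝ) × ℝ → ℝ) (hF : ContDiff ℝ (⊤ : ℕ∞) F) :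
    ContDiff ℝ (⊤ : ℕ∞) (fun p : ℝ × ℝ => ∫ t in (0:ℝ)..1, F (p, t)) :=
  contDiff_infty.2 fun n => had_param_aux n ℝ F hF

/-- Hadamard lemma in the first variable. -/
theorem had1 (G : ℝ × ℝ → ℝ) (hG : ContDiff ℝ (⊤ : ℕ∞) G) :
    ∃ H : ℝ × ℝ → ℝ, ContDiff ℝ (⊤ : ℕ∞) H ∧ ∀ u v, G (u, v) = G (0, v) + u * H (u, v) := by
  have hd : ContDiff ℝ (⊤ : ℕ∞) (fun x : (ℝ × ℝ) × ℝ =>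
      fderiv ℝ G (x.2 * x.1.1, x.1.2) ((1:ℝ), (0:ℝ))) := by
    have h1 : ContDiff ℝ (⊤ : ℕ∞) (fderiv ℝ G) := hG.fderiv_right (by simp)
    exact (h1.comp (by fun_prop)).clm_apply contDiff_const
  refine ⟨_, had_param _ hd, fun u v => ?_⟩
  have hder : ∀ t : ℝ, HasDerivAt (fun t => G (t * u, v))
      (u * fderiv ℝ G (t * u, v) ((1:ℝ), (0:ℝ))) t := by
    intro t
    have h1 : HasFDerivAt G (fderiv ℝ G (t * u, v)) (t * u, v) :=
      (hG.differentiable (by simp) _).hasFDerivAt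
    have h2 : HasDerivAt (fun t : ℝ => (t * u, v)) ((1 * u, (0:ℝ))) t :=
      ((hasDerivAt_id t).mul_const u).prodMk (hasDerivAt_const t v)
    have h3 := h1.comp_hasDerivAt t h2
    have e : fderiv ℝ G (t * u, v) ((1 * u, (0:ℝ))) = u * fderiv ℝ G (t * u, v) ((1:ℝ), (0:ℝ)) := by
      rw [← smul_eq_mul u (fderiv ℝ G (t * u, v) ((1:ℝ), (0:ℝ))), ← map_smul]
      simp
    rw [e] at h3
    exact h3
  have := intervalIntegral.integral_eq_sub_of_hasDerivAt (a := 0) (b := 1)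
    (fun t _ => hder t) (by
      apply Continuous.intervalIntegrable
      exact continuous_const.mul (hd.continuous.comp (Continuous.prodMk_right (u, v))))
  rw [intervalIntegral.integral_const_mul] at this
  simp only [one_mul, zero_mul] at this
  linarith

theorem had2 (G : ℝ × ℝ → ℝ) (hG : ContDiff ℝ (⊤ : ℕ∞) G) :
    ∃ H : ℝ × ℝ → ℝ, ContDiff ℝ (⊤ : ℕ∞) H ∧ ∀ u v, G (u, v) = G (u, 0) + v * H (u, v) := by
  obtain ⟨H, hH, h⟩ := had1 (fun p => G (p.2, p.1)) (hG.comp (by fun_prop))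
  exact ⟨fun p => H (p.2, p.1), hH.comp (by fun_prop), fun u v => h v u⟩

theorem had0 (g : ℝ → ℝ) (hg : ContDiff ℝ (⊤ : ℕ∞) g) :
    ∃ h : ℝ → ℝ, ContDiff ℝ (⊤ : ℕ∞) h ∧ ∀ u, g u = g 0 + u * h u := by
  obtain ⟨H, hH, h⟩ := had1 (fun p => g p.1) (hg.comp (by fun_prop))
  exact ⟨fun u => H (u, 0), hH.comp (by fun_prop), fun u => h u 0⟩

/-- extension by a bump function -/
theorem ext_bump (G : ℝ × ℝ → ℝ) (W : Set (ℝ × ℝ)) (hW : IsOpen W) (h0 : (0 : ℝ × ℝ) ∈ W)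
    (hG : ContDiffOn ℝ (⊤ : ℕ∞) G W) :
    ∃ H : ℝ × ℝ → ℝ, ContDiff ℝ (⊤ : ℕ∞) H ∧ ∀ᶠ p in 𝓝 0, G p = H p := by
  obtain ⟨r, hr, hrW⟩ := Metric.isOpen_iff.1 hW 0 h0
  let χ : ContDiffBump (0 : ℝ × ℝ) := ⟨r / 3, r / 2, by positivity, by linarith⟩
  refine ⟨fun p => χ p * G p, ?_, ?_⟩
  · rw [contDiff_iff_contDiffAt]
    intro p
    by_cases hp : p ∈ W
    · exact χ.contDiff.contDiffAt.mul (hG.contDiffAt (hW.mem_nhds hp))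
    · have : p ∉ tsupport χ := by
        rw [χ.tsupport_eq]
        intro h
        exact hp (hrW (Metric.closedBall_subset_ball (by show r / 2 < r; linarith) h))
      have h2 : (fun p => χ p * G p) =ᶠ[𝓝 p] fun _ => 0 := by
        filter_upwards [(isClosed_tsupport χ).isOpen_compl.mem_nhds this] with q hq
        rw [image_eq_zero_of_notMem_tsupport hq, zero_mul]
      exact contDiffAt_const.congr_of_eventuallyEq h2
  · filter_upwards [χ.eventuallyEq_one] with p hp
    simp at hp
    rw [hp, one_mul]

/-- structure lemma -/
theorem struct_lem (G : ℝ × ℝ → ℝ) (W : Set (ℝ × ℝ)) (hW : IsOpen W) (h0 : (0 : ℝ × ℝ) ∈ W)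
    (hG : ContDiffOn ℝ (⊤ : ℕ∞) G W) (hG0 : G 0 = 0)
    (h1 : ∀ v, ((0:ℝ), v) ∈ W → HasDerivAt (fun t => G (t, v)) 0 0)
    (h2 : ∀ u, (u, (0:ℝ)) ∈ W → HasDerivAt (fun t => G (u, t)) 0 0) :
    ∃ (P Q : ℝ → ℝ) (R : ℝ × ℝ → ℝ), ContDiff ℝ (⊤ : ℕ∞) P ∧ ContDiff ℝ (⊤ : ℕ∞) Q ∧
      ContDiff ℝ (⊤ : ℕ∞) R ∧
      ∀ᶠ p in 𝓝 (0 : ℝ × ℝ), G p = p.1 ^ 2 * P p.1 + p.2 ^ 2 * Q p.2 + p.1 ^ 2 * p.2 ^ 2 * R p := by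
  obtain ⟨H, hH, hGH⟩ := ext_bump G W hW h0 hG
  obtain ⟨r, hr, hrW⟩ := Metric.eventually_nhds_iff_ball.1 (hGH.and (hW.mem_nhds h0))
  have hmem : ∀ u v : ℝ, |u| < r → |v| < r → (u, v) ∈ Metric.ball (0 : ℝ × ℝ) r := by
    intro u v hu hv
    rw [mem_ball_zero_iff, Prod.norm_def, max_lt_iff]
    exact ⟨hu, hv⟩
  have hr0 : |(0:ℝ)| < r := by simpa using hr
  have hev : ∀ᶠ t : ℝ in 𝓝 0, |t| < r := by
    have : Continuous (fun t : ℝ => |t|) := by fun_prop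
    exact this.continuousAt.eventually_lt continuousAt_const hr0
  have hd1 : ∀ v, |v| < r → HasDerivAt (fun t => H (t, v)) 0 0 := by
    intro v hv
    refine (h1 v (hrW _ (hmem 0 v hr0 hv)).2).congr_of_eventuallyEq ?_
    filter_upwards [hev] with t ht
    exact ((hrW _ (hmem t v ht hv)).1).symm
  have hd2 : ∀ u, |u| < r → HasDerivAt (fun t => H (u, t)) 0 0 := by
    intro u hu
    refine (h2 u (hrW _ (hmem u 0 hu hr0)).2).congr_of_eventuallyEq ?_
    filter_upwards [hev] with t ht
    exact ((hrW _ (hmem u t hu ht)).1).symm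
  have hH0 : H (0, 0) = 0 := by
    exact ((hrW _ (hmem 0 0 hr0 hr0)).1).symm.trans hG0
  obtain ⟨H1, hH1, e1⟩ := had1 H hH
  obtain ⟨H2, hH2, e2⟩ := had1 H1 hH1
  obtain ⟨K1, hK1, f1⟩ := had2 H2 hH2
  obtain ⟨K2, hK2, f2⟩ := had2 K1 hK1
  obtain ⟨q1, hq1, g1⟩ := had0 (fun v => H (0, v)) (hH.comp (by fun_prop))
  obtain ⟨q2, hq2, g2⟩ := had0 q1 hq1
  have key0 : ∀ (h : ℝ → ℝ) (c : ℝ), Differentiable ℝ h → HasDerivAt (fun t => c + t * h t) (h 0) 0 := by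
    intro h c hh
    have := ((hasDerivAt_id (0:ℝ)).mul (hh 0).hasDerivAt).const_add c
    simpa using this
  have z1 : ∀ v, |v| < r → H1 (0, v) = 0 := by
    intro v hv
    have a1 := key0 (fun t => H1 (t, v)) (H (0, v))
      ((hH1.comp (by fun_prop : ContDiff ℝ (⊤ : ℕ∞) fun t : ℝ => (t, v))).differentiable (by simp))
    simp only [← e1] at a1
    exact a1.unique (hd1 v hv)
  have z2 : q1 0 = 0 := by
    have a1 := key0 q1 (H (0, 0)) (hq1.differentiable (by simp))
    simp only [← g1] at a1
    exact a1.unique (hd2 0 hr0)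
  have z3 : ∀ u, |u| < r → u ^ 2 * K1 (u, 0) = 0 := by
    intro u hu
    have e : (fun t => H (u, t)) =ᶠ[𝓝 0]
        fun t => u ^ 2 * H2 (u, 0) + t * (t * q2 t + u ^ 2 * K1 (u, t)) := by
      filter_upwards [hev] with t ht
      rw [e1, e2, f1, z1 t ht, g1, g2, z2, hH0]
      ring
    have a1 := key0 (fun t => t * q2 t + u ^ 2 * K1 (u, t)) (u ^ 2 * H2 (u, 0)) (by
      have : ContDiff ℝ (⊤ : ℕ∞) (fun t => t * q2 t + u ^ 2 * K1 (u, t)) :=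
        (contDiff_id.mul hq2).add (contDiff_const.mul (hK1.comp (by fun_prop)))
      exact this.differentiable (by simp))
    have a2 := (a1.congr_of_eventuallyEq e).unique (hd2 u hu)
    simpa using a2
  refine ⟨fun u => H2 (u, 0), q2, K2, hH2.comp (by fun_prop), hq2, hK2, ?_⟩
  filter_upwards [Metric.ball_mem_nhds (0 : ℝ × ℝ) hr] with p hp
  have hp' := hp
  rw [mem_ball_zero_iff, Prod.norm_def, max_lt_iff] at hp'
  obtain ⟨u, v⟩ := p
  have hz3 := z3 u hp'.1
  rw [(hrW _ hp).1, e1, e2, f1, f2, z1 v hp'.2, g1, g2, z2, hH0]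
  linear_combination v * hz3

theorem det2 (L : ℝ × ℝ →L[ℝ] ℝ × ℝ) : LinearMap.det L.toLinearMap =
    (L (1, 0)).1 * (L (0, 1)).2 - (L (0, 1)).1 * (L (1, 0)).2 := by
  rw [← LinearMap.det_toMatrix (Module.Basis.finTwoProd ℝ), Matrix.det_fin_two]
  simp [LinearMap.toMatrix_apply]

/-- straightening map -/
def sS (P Q : ℝ → ℝ) (R : ℝ × ℝ → ℝ) (p : ℝ × ℝ) : ℝ × ℝ :=
  (p.1 * √(P p.1 + p.2 ^ 2 * R p), p.2 * √(-Q p.2))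

theorem sS_d1 (P Q : ℝ → ℝ) (R : ℝ × ℝ → ℝ) (hP : ContDiff ℝ (⊤ : ℕ∞) P)
    (hR : ContDiff ℝ (⊤ : ℕ∞) R) (v : ℝ)
    (h : 0 < P 0 + v ^ 2 * R (0, v)) :
    HasDerivAt (fun t => sS P Q R (t, v)) (√(P 0 + v ^ 2 * R (0, v)), 0) 0 := by
  have h1 : DifferentiableAt ℝ (fun t => √(P t + v ^ 2 * R (t, v))) 0 := by
    refine DifferentiableAt.sqrt ?_ h.ne'
    have : ContDiff ℝ (⊤ : ℕ∞) (fun t => P t + v ^ 2 * R (t, v)) :=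
      hP.add (contDiff_const.mul (hR.comp (by fun_prop)))
    exact this.differentiable (by simp) _
  have h2 := (hasDerivAt_id (0:ℝ)).mul h1.hasDerivAt
  have h3 := h2.prodMk (hasDerivAt_const (0:ℝ) (v * √(-Q v)))
  simpa [sS] using h3

theorem sS_d2 (P Q : ℝ → ℝ) (R : ℝ × ℝ → ℝ) (hQ : ContDiff ℝ (⊤ : ℕ∞) Q)
    (hR : ContDiff ℝ (⊤ : ℕ∞) R) (u : ℝ)
    (h : 0 < P u) (hq : 0 < - Q 0) :
    HasDerivAt (fun t => sS P Q R (u, t)) (0, √(-Q 0)) 0 := by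
  have h1 : DifferentiableAt ℝ (fun t => √(- Q t)) 0 := by
    refine DifferentiableAt.sqrt ?_ hq.ne'
    exact (hQ.differentiable (by simp) _).neg
  have h2 := (hasDerivAt_id (0:ℝ)).mul h1.hasDerivAt
  have h4 : HasDerivAt (fun t => P u + t ^ 2 * R (u, t)) 0 0 := by
    have hd : DifferentiableAt ℝ (fun t => R (u, t)) 0 :=
      (hR.comp (by fun_prop : ContDiff ℝ (⊤ : ℕ∞) fun t : ℝ => (u, t))).differentiable (by simp) _
    have := ((hasDerivAt_pow 2 (0:ℝ)).mul hd.hasDerivAt).const_add (P u)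
    simpa using this
  have h5 := (h4.sqrt (by simpa using h.ne')).const_mul u
  have h3 := h5.prodMk h2
  simpa [sS] using h3

theorem straighten (P Q : ℝ → ℝ) (R : ℝ × ℝ → ℝ) (hP : ContDiff ℝ (⊤ : ℕ∞) P)
    (hQ : ContDiff ℝ (⊤ : ℕ∞) Q) (hR : ContDiff ℝ (⊤ : ℕ∞) R) (hP0 : 0 < P 0) (hQ0 : Q 0 < 0)
    (N : Set (ℝ × ℝ)) (hN : IsOpen N) (hN0 : (0 : ℝ × ℝ) ∈ N) :
    ∃ (U V : Set (ℝ × ℝ)) (sInv : ℝ × ℝ → ℝ × ℝ), IsOpen U ∧ IsOpen V ∧ (0 : ℝ × ℝ) ∈ U ∧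
      (0 : ℝ × ℝ) ∈ V ∧ U ⊆ N ∧ ContDiffOn ℝ (⊤ : ℕ∞) (sS P Q R) U ∧
      ContDiffOn ℝ (⊤ : ℕ∞) sInv V ∧ Set.MapsTo (sS P Q R) U V ∧ Set.MapsTo sInv V U ∧
      (∀ p ∈ U, sInv (sS P Q R p) = p) ∧ (∀ p ∈ V, sS P Q R (sInv p) = p) ∧
      (∀ p ∈ U, 0 < LinearMap.det ((fderiv ℝ (sS P Q R) p).toLinearMap)) ∧
      (∀ p ∈ U, 0 < P p.1 + p.2 ^ 2 * R p ∧ 0 < - Q p.2) := by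
  set s := sS P Q R with hs
  have cg : ContDiff ℝ (⊤ : ℕ∞) (fun p : ℝ × ℝ => P p.1 + p.2 ^ 2 * R p) :=
    (hP.comp contDiff_fst).add ((contDiff_snd.pow 2).mul hR)
  have ch : ContDiff ℝ (⊤ : ℕ∞) (fun p : ℝ × ℝ => - Q p.2) := (hQ.comp contDiff_snd).neg
  set U0 : Set (ℝ × ℝ) := {p | 0 < P p.1 + p.2 ^ 2 * R p ∧ 0 < - Q p.2} with hU0
  have hU0o : IsOpen U0 :=
    (isOpen_lt continuous_const cg.continuous).inter (isOpen_lt continuous_const ch.continuous)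
  have hU00 : (0 : ℝ × ℝ) ∈ U0 := by
    constructor
    · simpa using hP0
    · simpa using hQ0
  have hsU0 : ContDiffOn ℝ (⊤ : ℕ∞) s U0 := by
    intro p hp
    apply ContDiffAt.contDiffWithinAt
    have a1 : ContDiffAt ℝ (⊤ : ℕ∞) (fun p : ℝ × ℝ => √(P p.1 + p.2 ^ 2 * R p)) p :=
      cg.contDiffAt.sqrt hp.1.ne'
    have a2 : ContDiffAt ℝ (⊤ : ℕ∞) (fun p : ℝ × ℝ => √(- Q p.2)) p :=
      ch.contDiffAt.sqrt hp.2.ne'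
    exact (contDiffAt_fst.mul a1).prodMk (contDiffAt_snd.mul a2)
  have hsat : ∀ p ∈ U0, ContDiffAt ℝ (⊤ : ℕ∞) s p := fun p hp => hsU0.contDiffAt (hU0o.mem_nhds hp)
  have hdet0 : 0 < LinearMap.det ((fderiv ℝ s 0).toLinearMap) := by
    have hd : HasFDerivAt s (fderiv ℝ s 0) ((0:ℝ), (0:ℝ)) :=
      ((hsat 0 hU00).differentiableAt (by simp)).hasFDerivAt
    have e1 : fderiv ℝ s 0 (1, 0) = (√(P 0 + 0 ^ 2 * R (0, 0)), 0) := by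
      have h1 := hd.comp_hasDerivAt_of_eq (0:ℝ) (f := fun t : ℝ => (t, (0:ℝ)))
        ((hasDerivAt_id (0:ℝ)).prodMk (hasDerivAt_const (0:ℝ) (0:ℝ))) rfl
      exact h1.unique (sS_d1 P Q R hP hR 0 (by simpa using hP0))
    have e2 : fderiv ℝ s 0 (0, 1) = (0, √(-Q 0)) := by
      have h1 := hd.comp_hasDerivAt_of_eq (0:ℝ) (f := fun t : ℝ => ((0:ℝ), t))
        ((hasDerivAt_const (0:ℝ) (0:ℝ)).prodMk (hasDerivAt_id (0:ℝ))) rfl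
      exact h1.unique (sS_d2 P Q R hQ hR 0 hP0 (by linarith))
    rw [det2, e1, e2]
    simp only [mul_zero, sub_zero]
    refine mul_pos (Real.sqrt_pos.2 (by simpa using hP0)) (Real.sqrt_pos.2 (by linarith))
  have hfd : ContinuousOn (fun p => fderiv ℝ s p) U0 := hsU0.continuousOn_fderiv_of_isOpen hU0o (by simp)
  have hdetc : ContinuousOn (fun p => LinearMap.det ((fderiv ℝ s p).toLinearMap)) U0 := by
    simp only [det2]
    have b1 : ContinuousOn (fun p => fderiv ℝ s p (1, 0)) U0 := hfd.clm_apply continuousOn_const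
    have b2 : ContinuousOn (fun p => fderiv ℝ s p (0, 1)) U0 := hfd.clm_apply continuousOn_const
    exact (b1.fst.mul b2.snd).sub (b2.fst.mul b1.snd)
  set U1 : Set (ℝ × ℝ) := U0 ∩ (fun p => LinearMap.det ((fderiv ℝ s p).toLinearMap)) ⁻¹' Set.Ioi 0
  have hU1o : IsOpen U1 := hdetc.isOpen_inter_preimage hU0o isOpen_Ioi
  have hequiv : ∀ p ∈ U1, ∃ L : (ℝ × ℝ) ≃L[ℝ] (ℝ × ℝ),
      HasFDerivAt s (L : ℝ × ℝ →L[ℝ] ℝ × ℝ) p := by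
    intro p hp
    have hd : HasFDerivAt s (fderiv ℝ s p) p :=
      ((hsat p hp.1).differentiableAt (by simp)).hasFDerivAt
    have hne : (fderiv ℝ s p).det ≠ 0 := (show 0 < (fderiv ℝ s p).det from hp.2).ne'
    refine ⟨(fderiv ℝ s p).toContinuousLinearEquivOfDetNeZero hne, ?_⟩
    simpa using hd
  obtain ⟨L0, hL0⟩ := hequiv 0 ⟨hU00, hdet0⟩
  have hs0 : s 0 = 0 := by simp [hs, sS]
  let e := (hsat 0 hU00).toOpenPartialHomeomorph s hL0 (by simp)
  have hecoe : (e : ℝ × ℝ → ℝ × ℝ) = s := rfl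
  have he0 : (0 : ℝ × ℝ) ∈ e.source := ContDiffAt.mem_toOpenPartialHomeomorph_source _ _ _
  set U := e.source ∩ (U1 ∩ N)
  have hUo : IsOpen U := e.open_source.inter (hU1o.inter hN)
  have hU : (0 : ℝ × ℝ) ∈ U := ⟨he0, ⟨hU00, hdet0⟩, hN0⟩
  have hV : IsOpen (e.target ∩ e.symm ⁻¹' U) := e.isOpen_inter_preimage_symm hUo
  refine ⟨U, e.target ∩ e.symm ⁻¹' U, e.symm, hUo, hV, hU, ?_, fun p hp => hp.2.2,
    hsU0.mono fun p hp => hp.2.1.1, ?_, ?_, fun p hp => hp.2, fun p hp => e.left_inv hp.1,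
    fun p hp => e.right_inv hp.1, fun p hp => hp.2.1.2, fun p hp => hp.2.1.1⟩
  · have h1 : e 0 = 0 := hs0
    have h2 := e.map_source he0
    have h3 := e.left_inv he0
    rw [h1] at h2 h3
    refine ⟨h2, ?_⟩
    rw [Set.mem_preimage, h3]
    exact hU
  · intro p hp
    obtain ⟨L, hL⟩ := hequiv _ hp.2.2.1
    exact (e.contDiffAt_symm hp.1 hL (hsat _ hp.2.2.1.1)).contDiffWithinAt
  · intro p hp
    refine ⟨e.map_source hp.1, ?_⟩
    rw [Set.mem_preimage, ← hecoe, e.left_inv hp.1]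
    exact hp

theorem cont_lim (f g : ℝ → ℝ) (hf : Continuous f) (hg : ContinuousAt g 0)
    (h : ∀ᶠ t in 𝓝 (0:ℝ), t ≠ 0 → f t = g t) : f 0 = g 0 := by
  have h1 : Tendsto f (𝓝[≠] 0) (𝓝 (f 0)) := hf.continuousAt.tendsto.mono_left nhdsWithin_le_nhds
  have h2 : Tendsto g (𝓝[≠] 0) (𝓝 (g 0)) := hg.tendsto.mono_left nhdsWithin_le_nhds
  refine tendsto_nhds_unique (h1.congr' ?_) h2
  rw [EventuallyEq, eventually_nhdsWithin_iff]
  exact h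

theorem comp_lem (P Q : ℝ → ℝ) (R : ℝ × ℝ → ℝ) (hP : ContDiff ℝ (⊤ : ℕ∞) P)
    (hQ : ContDiff ℝ (⊤ : ℕ∞) Q) (hR : ContDiff ℝ (⊤ : ℕ∞) R)
    (U V : Set (ℝ × ℝ)) (sInv : ℝ × ℝ → ℝ × ℝ) (hU : IsOpen U) (hV : IsOpen V)
    (hU0 : (0 : ℝ × ℝ) ∈ U) (hV0 : (0 : ℝ × ℝ) ∈ V)
    (hsI : ContDiffOn ℝ (⊤ : ℕ∞) sInv V) (hsm : Set.MapsTo (sS P Q R) U V)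
    (hsc : ContDiffOn ℝ (⊤ : ℕ∞) (sS P Q R) U)
    (hsIm : Set.MapsTo sInv V U)
    (hl : ∀ p ∈ U, sInv (sS P Q R p) = p) (hr : ∀ p ∈ V, sS P Q R (sInv p) = p)
    (hpos : ∀ p ∈ U, 0 < P p.1 + p.2 ^ 2 * R p ∧ 0 < - Q p.2)
    (F : ℝ × ℝ → ℝ) (hF : ContDiffOn ℝ (⊤ : ℕ∞) F U) (hF0 : F 0 = 0)
    (h1 : ∀ v, ((0:ℝ), v) ∈ U → HasDerivAt (fun t => F (t, v)) 0 0)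
    (h2 : ∀ u, (u, (0:ℝ)) ∈ U → HasDerivAt (fun t => F (u, t)) 0 0)
    (PF QF : ℝ → ℝ) (RF : ℝ × ℝ → ℝ) (hPF : Continuous PF) (hQF : Continuous QF)
    (hFe : ∀ᶠ p in 𝓝 (0 : ℝ × ℝ), F p =
      p.1 ^ 2 * PF p.1 + p.2 ^ 2 * QF p.2 + p.1 ^ 2 * p.2 ^ 2 * RF p) :
    ∃ (P' Q' : ℝ → ℝ) (R' : ℝ × ℝ → ℝ), ContDiff ℝ (⊤ : ℕ∞) P' ∧ ContDiff ℝ (⊤ : ℕ∞) Q' ∧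
      ContDiff ℝ (⊤ : ℕ∞) R' ∧ PF 0 = P 0 * P' 0 ∧ QF 0 = - Q 0 * Q' 0 ∧
      ∀ᶠ p in 𝓝 (0 : ℝ × ℝ), F (sInv p) =
        p.1 ^ 2 * P' p.1 + p.2 ^ 2 * Q' p.2 + p.1 ^ 2 * p.2 ^ 2 * R' p := by
  set s := sS P Q R with hs
  set G : ℝ × ℝ → ℝ := fun p => F (sInv p) with hGdef
  have hG : ContDiffOn ℝ (⊤ : ℕ∞) G V := hF.comp hsI hsIm
  have hs0 : s 0 = 0 := by simp [hs, sS]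
  have hsI0 : sInv 0 = 0 := by rw [← hs0]; rw [hs0]; have := hl 0 hU0; rwa [hs0] at this
  have hG0 : G 0 = 0 := by simp [hGdef, hsI0, hF0]
  have hGd : ∀ p ∈ V, HasFDerivAt G (fderiv ℝ G p) p := fun p hp =>
    ((hG.contDiffAt (hV.mem_nhds hp)).differentiableAt (by simp)).hasFDerivAt
  have hGs : ∀ q ∈ U, G (s q) = F q := by
    intro q hq; simp only [hGdef]; rw [hl q hq]
  have g1 : ∀ v, ((0:ℝ), v) ∈ V → HasDerivAt (fun t => G (t, v)) 0 0 := by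
    intro v hv
    obtain ⟨⟨a, b⟩, hab⟩ : ∃ q, q = sInv (0, v) := ⟨_, rfl⟩
    have hq : (a, b) ∈ U := hab ▸ hsIm hv
    have hsq : s (a, b) = (0, v) := by rw [hab]; exact hr _ hv
    have ha : a = 0 := by
      have h3 : a * √(P a + b ^ 2 * R (a, b)) = 0 := congrArg Prod.fst hsq
      exact (mul_eq_zero.1 h3).resolve_right (Real.sqrt_pos.2 (hpos _ hq).1).ne'
    subst ha
    have hk := Real.sqrt_pos.2 (hpos _ hq).1
    set κ := √(P 0 + b ^ 2 * R (0, b))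
    have d1 := sS_d1 P Q R hP hR b (hpos _ hq).1
    have d2 := (hGd (0, v) hv).comp_hasDerivAt_of_eq (0:ℝ) d1 hsq.symm
    have d3 : HasDerivAt (G ∘ fun t => sS P Q R (t, b)) 0 0 := by
      refine (h1 b hq).congr_of_eventuallyEq ?_
      have hc : ContinuousAt (fun t : ℝ => (t, b)) 0 := by fun_prop
      filter_upwards [hc.eventually_mem (hU.mem_nhds hq)] with t ht
      exact hGs _ ht
    have d4 := d2.unique d3
    have d5 := (hGd (0, v) hv).comp_hasDerivAt (0:ℝ)
      ((hasDerivAt_id (0:ℝ)).prodMk (hasDerivAt_const (0:ℝ) v))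
    have d6 : fderiv ℝ G (0, v) (1, 0) = 0 := by
      have : ((κ, 0) : ℝ × ℝ) = κ • ((1, 0) : ℝ × ℝ) := by simp
      rw [this, map_smul, smul_eq_mul] at d4
      exact (mul_eq_zero.1 d4).resolve_left hk.ne'
    rw [d6] at d5
    exact d5
  have g2 : ∀ u, (u, (0:ℝ)) ∈ V → HasDerivAt (fun t => G (u, t)) 0 0 := by
    intro u hv
    obtain ⟨⟨a, b⟩, hab⟩ : ∃ q, q = sInv (u, 0) := ⟨_, rfl⟩
    have hq : (a, b) ∈ U := hab ▸ hsIm hv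
    have hsq : s (a, b) = (u, 0) := by rw [hab]; exact hr _ hv
    have hb : b = 0 := by
      have h3 : b * √(-Q b) = 0 := congrArg Prod.snd hsq
      exact (mul_eq_zero.1 h3).resolve_right (Real.sqrt_pos.2 (hpos _ hq).2).ne'
    subst hb
    have hk := Real.sqrt_pos.2 (hpos _ hq).2
    simp only at hk
    have hPa : 0 < P a := by simpa using (hpos _ hq).1
    have d1 := sS_d2 P Q R hQ hR a hPa (hpos _ hq).2
    set κ := √(- Q 0)
    have d2 := (hGd (u, 0) hv).comp_hasDerivAt_of_eq (0:ℝ) d1 hsq.symm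
    have d3 : HasDerivAt (G ∘ fun t => sS P Q R (a, t)) 0 0 := by
      refine (h2 a hq).congr_of_eventuallyEq ?_
      have hc : ContinuousAt (fun t : ℝ => (a, t)) 0 := by fun_prop
      filter_upwards [hc.eventually_mem (hU.mem_nhds hq)] with t ht
      exact hGs _ ht
    have d4 := d2.unique d3
    have d5 := (hGd (u, 0) hv).comp_hasDerivAt (0:ℝ)
      ((hasDerivAt_const (0:ℝ) u).prodMk (hasDerivAt_id (0:ℝ)))
    have d6 : fderiv ℝ G (u, 0) (0, 1) = 0 := by
      have : ((0, κ) : ℝ × ℝ) = κ • ((0, 1) : ℝ × ℝ) := by simp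
      rw [this, map_smul, smul_eq_mul] at d4
      exact (mul_eq_zero.1 d4).resolve_left hk.ne'
    rw [d6] at d5
    exact d5
  obtain ⟨P', Q', R', hP', hQ', hR', hE⟩ := struct_lem G V hV hV0 hG hG0 g1 g2
  refine ⟨P', Q', R', hP', hQ', hR', ?_, ?_, hE⟩
  · have hsct : ContinuousAt s 0 := (hsc.contDiffAt (hU.mem_nhds hU0)).continuousAt
    have hE2 : ∀ᶠ q in 𝓝 (0 : ℝ × ℝ), G (s q) = (s q).1 ^ 2 * P' (s q).1 +
        (s q).2 ^ 2 * Q' (s q).2 + (s q).1 ^ 2 * (s q).2 ^ 2 * R' (s q) := by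
      have : Tendsto s (𝓝 0) (𝓝 0) := by simpa [ContinuousAt, hs0] using hsct
      exact this.eventually hE
    have hall := (hE2.and hFe).and (hU.mem_nhds hU0)
    have hc : Tendsto (fun t : ℝ => (t, (0:ℝ))) (𝓝 0) (𝓝 (0 : ℝ × ℝ)) :=
      (by fun_prop : ContinuousAt (fun t : ℝ => (t, (0:ℝ))) 0).tendsto
    have := cont_lim PF (fun t => P t * P' (t * √(P t))) hPF
      (hP.continuous.mul (hP'.continuous.comp (continuous_id.mul hP.continuous.sqrt))).continuousAt ?_
    · simpa using this
    · filter_upwards [hc.eventually hall] with t ⟨⟨k1, k2⟩, k3⟩ ht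
      rw [hGs _ k3, k2] at k1
      have hp := (hpos _ k3).1
      simp only [hs, sS] at k1
      norm_num at k1 hp
      rw [mul_pow, Real.sq_sqrt hp.le, mul_assoc] at k1
      exact mul_left_cancel₀ (pow_ne_zero 2 ht) k1
  · have hsct : ContinuousAt s 0 := (hsc.contDiffAt (hU.mem_nhds hU0)).continuousAt
    have hE2 : ∀ᶠ q in 𝓝 (0 : ℝ × ℝ), G (s q) = (s q).1 ^ 2 * P' (s q).1 +
        (s q).2 ^ 2 * Q' (s q).2 + (s q).1 ^ 2 * (s q).2 ^ 2 * R' (s q) := by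
      have : Tendsto s (𝓝 0) (𝓝 0) := by simpa [ContinuousAt, hs0] using hsct
      exact this.eventually hE
    have hall := (hE2.and hFe).and (hU.mem_nhds hU0)
    have hc : Tendsto (fun t : ℝ => ((0:ℝ), t)) (𝓝 0) (𝓝 (0 : ℝ × ℝ)) :=
      (by fun_prop : ContinuousAt (fun t : ℝ => ((0:ℝ), t)) 0).tendsto
    have := cont_lim QF (fun t => - Q t * Q' (t * √(- Q t))) hQF
      (hQ.continuous.neg.mul (hQ'.continuous.comp (continuous_id.mul hQ.continuous.neg.sqrt))).continuousAt ?_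
    · simpa using this
    · filter_upwards [hc.eventually hall] with t ⟨⟨k1, k2⟩, k3⟩ ht
      rw [hGs _ k3, k2] at k1
      have hp : 0 < - Q t := (hpos _ k3).2
      simp only [hs, sS] at k1
      norm_num at k1
      rw [mul_pow, Real.sq_sqrt hp.le, mul_assoc] at k1
      exact mul_left_cancel₀ (pow_ne_zero 2 ht) k1

theorem frame_mat (e1 e2 : Fin 3 → ℝ) (h11 : dot3 e1 e1 = 1) (h22 : dot3 e2 e2 = 1)
    (h12 : dot3 e1 e2 = 0) :
    (Matrix.of ![e1, e2, cross3 e1 e2]) * (Matrix.of ![e1, e2, cross3 e1 e2]).transpose = 1 ∧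
    (Matrix.of ![e1, e2, cross3 e1 e2]).det = 1 := by
  simp only [dot3] at h11 h22 h12
  have hl : (e1 1 * e2 2 - e1 2 * e2 1) ^ 2 + (e1 2 * e2 0 - e1 0 * e2 2) ^ 2 +
      (e1 0 * e2 1 - e1 1 * e2 0) ^ 2 = 1 := by
    linear_combination (e2 0 * e2 0 + e2 1 * e2 1 + e2 2 * e2 2) * h11 + h22 -
      (e1 0 * e2 0 + e1 1 * e2 1 + e1 2 * e2 2) * h12
  constructor
  · ext i j
    fin_cases i <;> fin_cases j <;>
      simp [Matrix.mul_apply, Fin.sum_univ_three, cross3] <;>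
      first
      | linear_combination h11
      | linear_combination h22
      | linear_combination h12
      | linear_combination hl
      | ring
  · rw [Matrix.det_fin_three]
    simp [cross3]
    linear_combination hl

theorem frame_exists (p q : Fin 3 → ℝ) (hli : LinearIndependent ℝ ![p, q]) :
    ∃ (A : Matrix (Fin 3) (Fin 3) ℝ) (a : ℝ), 0 ≤ a ∧ A * A.transpose = 1 ∧ A.det = 1 ∧
      0 < A.mulVec p 0 ∧ A.mulVec q 0 < 0 ∧ A.mulVec p 2 = 0 ∧ A.mulVec q 2 = 0 ∧
      A.mulVec p 1 = a * A.mulVec p 0 ∧ A.mulVec q 1 = - a * A.mulVec q 0 := by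
  rw [LinearIndependent.pair_iff] at hli
  have zero_of : ∀ x : Fin 3 → ℝ, dot3 x x ≤ 0 → x = 0 := by
    intro x hx
    simp only [dot3] at hx
    ext i
    fin_cases i <;> simp <;> nlinarith [mul_self_nonneg (x 0), mul_self_nonneg (x 1), mul_self_nonneg (x 2)]
  have hp : 0 < dot3 p p := by
    by_contra h
    have := zero_of p (not_lt.1 h)
    have := (hli 1 0 (by simp [this])).1
    simp at this
  have hq : 0 < dot3 q q := by
    by_contra h
    have := zero_of q (not_lt.1 h)
    have := (hli 0 1 (by simp [this])).2
    simp at this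
  have hpq : dot3 p q ^ 2 < dot3 p p * dot3 q q := by
    by_contra h
    have h' := not_lt.1 h
    have hw := zero_of (dot3 q q • p + (- dot3 p q) • q) (by
      have : dot3 (dot3 q q • p + (- dot3 p q) • q) (dot3 q q • p + (- dot3 p q) • q) =
          dot3 q q * (dot3 p p * dot3 q q - dot3 p q ^ 2) := by
        simp [dot3]; ring
      rw [this]
      exact mul_nonpos_of_nonneg_of_nonpos hq.le (by linarith))
    exact hq.ne' (hli _ _ hw).1
  obtain ⟨n, hn, hnn⟩ : ∃ n : ℝ, 0 < n ∧ n ^ 2 = dot3 p p := ⟨√(dot3 p p), Real.sqrt_pos.2 hp, Real.sq_sqrt hp.le⟩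
  obtain ⟨m, hm, hmm⟩ : ∃ m : ℝ, 0 < m ∧ m ^ 2 = dot3 q q := ⟨√(dot3 q q), Real.sqrt_pos.2 hq, Real.sq_sqrt hq.le⟩
  have hab : |dot3 p q| < n * m := by
    refine abs_lt_of_sq_lt_sq ?_ (by positivity)
    rw [mul_pow, hnn, hmm]; exact hpq
  obtain ⟨hd1, hd2⟩ := abs_lt.1 hab
  set d := dot3 p q with hd
  have hx : 0 < 2 * n * m * (n * m - d) := by
    have : 0 < n * m - d := by linarith
    positivity
  have hy : 0 < 2 * n * m * (n * m + d) := by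
    have : 0 < n * m + d := by linarith
    positivity
  obtain ⟨x, hx0, hxx⟩ : ∃ x : ℝ, 0 < x ∧ x ^ 2 = 2 * n * m * (n * m - d) := ⟨√_, Real.sqrt_pos.2 hx, Real.sq_sqrt hx.le⟩
  obtain ⟨y, hy0, hyy⟩ : ∃ y : ℝ, 0 < y ∧ y ^ 2 = 2 * n * m * (n * m + d) := ⟨√_, Real.sqrt_pos.2 hy, Real.sq_sqrt hy.le⟩
  set e1 : Fin 3 → ℝ := x⁻¹ • (m • p - n • q) with he1
  set e2 : Fin 3 → ℝ := y⁻¹ • (m • p + n • q) with he2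
  have bil : ∀ (c s t c' s' t' : ℝ), dot3 (c • (s • p + t • q)) (c' • (s' • p + t' • q)) =
      c * c' * (s * s' * n ^ 2 + (s * t' + t * s') * d + t * t' * m ^ 2) := by
    intros
    rw [hnn, hmm, hd]; simp [dot3]; ring
  have he1' : e1 = x⁻¹ • (m • p + (-n) • q) := by rw [he1]; simp [sub_eq_add_neg]
  have hp' : p = (1:ℝ) • ((1:ℝ) • p + (0:ℝ) • q) := by simp
  have hq' : q = (1:ℝ) • ((0:ℝ) • p + (1:ℝ) • q) := by simp
  have h11 : dot3 e1 e1 = 1 := by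
    rw [he1', bil]
    field_simp
    rw [hxx]; ring
  have h22 : dot3 e2 e2 = 1 := by
    rw [he2, bil]
    field_simp
    rw [hyy]; ring
  have h12 : dot3 e1 e2 = 0 := by
    rw [he1', he2, bil]
    ring
  have e1p : dot3 e1 p = x / (2 * m) := by
    have := bil x⁻¹ m (-n) 1 1 0
    rw [← hp', ← he1'] at this
    rw [this]; field_simp; rw [hxx]; ring
  have e1q : dot3 e1 q = - (x / (2 * n)) := by
    have := bil x⁻¹ m (-n) 1 0 1
    rw [← hq', ← he1'] at this
    rw [this]; field_simp; rw [hxx]; ring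
  have e2p : dot3 e2 p = y / (2 * m) := by
    have := bil y⁻¹ m n 1 1 0
    rw [← hp', ← he2] at this
    rw [this]; field_simp; rw [hyy]; ring
  have e2q : dot3 e2 q = y / (2 * n) := by
    have := bil y⁻¹ m n 1 0 1
    rw [← hq', ← he2] at this
    rw [this]; field_simp; rw [hyy]; ring
  have e3p : dot3 (cross3 e1 e2) p = 0 := by
    rw [he1, he2]; simp [dot3, cross3]; ring
  have e3q : dot3 (cross3 e1 e2) q = 0 := by
    rw [he1, he2]; simp [dot3, cross3]; ring
  obtain ⟨k1, k2⟩ := frame_mat e1 e2 h11 h22 h12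
  have mv : ∀ z : Fin 3 → ℝ, (Matrix.of ![e1, e2, cross3 e1 e2]).mulVec z =
      ![dot3 e1 z, dot3 e2 z, dot3 (cross3 e1 e2) z] := by
    intro z
    ext i
    fin_cases i <;> simp [Matrix.mulVec, dotProduct, Fin.sum_univ_three, dot3]
  refine ⟨_, y / x, by positivity, k1, k2, ?_⟩
  rw [mv, mv]
  simp only [Matrix.cons_val_zero, Matrix.cons_val_one, Matrix.cons_val, e1p, e1q, e2p, e2q, e3p, e3q]
  refine ⟨by positivity, by rw [neg_lt_zero]; positivity, trivial, trivial, by field_simp, by field_simp⟩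

/-- normal form with prescribed leading coefficients of `c1`, `c3`. -/
def GoodNF (f : ℝ × ℝ → Fin 3 → ℝ) (x y : ℝ) : Prop :=
    ∃ (a : ℝ) (b1 b3 c1 c3 : ℝ → ℝ) (b2 c2 : ℝ × ℝ → ℝ) (U V : Set (ℝ × ℝ))
      (s sInv : ℝ × ℝ → ℝ × ℝ) (A : Matrix (Fin 3) (Fin 3) ℝ),
      0 ≤ a ∧
      ContDiff ℝ (⊤ : ℕ∞) b1 ∧ ContDiff ℝ (⊤ : ℕ∞) b3 ∧ ContDiff ℝ (⊤ : ℕ∞) c1 ∧ ContDiff ℝ (⊤ : ℕ∞) c3 ∧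
      c1 0 = x ∧ c3 0 = y ∧ ContDiff ℝ (⊤ : ℕ∞) b2 ∧ ContDiff ℝ (⊤ : ℕ∞) c2 ∧
      IsOpen U ∧ IsOpen V ∧ (0 : ℝ × ℝ) ∈ U ∧ (0 : ℝ × ℝ) ∈ V ∧
      ContDiffOn ℝ (⊤ : ℕ∞) s U ∧ ContDiffOn ℝ (⊤ : ℕ∞) sInv V ∧ s 0 = 0 ∧
      Set.MapsTo s U V ∧ Set.MapsTo sInv V U ∧
      (∀ p ∈ U, sInv (s p) = p) ∧ (∀ p ∈ V, s (sInv p) = p) ∧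
      (∀ p ∈ U, 0 < LinearMap.det ((fderiv ℝ s p).toLinearMap)) ∧
      A * A.transpose = 1 ∧ A.det = 1 ∧
      (∀ p ∈ V, A.mulVec (f (sInv p)) = NF a b1 b3 c1 c3 b2 c2 p)

theorem GoodNF.rot {f : ℝ × ℝ → Fin 3 → ℝ} {x y : ℝ} (h : GoodNF f x y) : GoodNF f y (-x) := by
  obtain ⟨a, b1, b3, c1, c3, b2, c2, U, V, s, sInv, A, ha, hb1, hb3, hc1, hc3, hx, hy, hb2, hc2,
    hU, hV, hU0, hV0, hs, hsI, hs0, hm, hmI, hl, hr, hdet, hA, hA1, hnf⟩ := h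
  have cJ : ContDiff ℝ (⊤ : ℕ∞) (fun p : ℝ × ℝ => (p.2, -p.1)) := by fun_prop
  have cJ' : ContDiff ℝ (⊤ : ℕ∞) (fun p : ℝ × ℝ => (-p.2, p.1)) := by fun_prop
  have cn : ContDiff ℝ (⊤ : ℕ∞) (fun t : ℝ => -t) := by fun_prop
  set D : Matrix (Fin 3) (Fin 3) ℝ := Matrix.diagonal ![-1, 1, -1] with hD
  have hDD : D * D.transpose = 1 := by
    rw [hD, Matrix.diagonal_transpose, Matrix.diagonal_mul_diagonal, ← Matrix.diagonal_one]
    congr 1; ext i; fin_cases i <;> simp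
  have hDdet : D.det = 1 := by
    rw [hD, Matrix.det_diagonal]; simp [Fin.prod_univ_three]
  refine ⟨a, fun u => - b3 (-u), b1, fun u => c3 (-u), fun v => - c1 v, fun p => b2 (p.2, -p.1),
    fun p => - c2 (p.2, -p.1), U, (fun p : ℝ × ℝ => (p.2, -p.1)) ⁻¹' V,
    fun p => (-(s p).2, (s p).1), fun p => sInv (p.2, -p.1), D * A, ha,
    (hb3.comp cn).neg, hb1, hc3.comp cn, hc1.neg, by simpa using hy, by simp [hx], hb2.comp cJ,
    (hc2.comp cJ).neg, hU, hV.preimage cJ.continuous, hU0, by simpa [← Prod.zero_eq_mk] using hV0,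
    cJ'.comp_contDiffOn hs, hsI.comp cJ.contDiffOn (fun p hp => hp), by simp [hs0], ?_,
    fun p hp => hmI hp, ?_, ?_, ?_, ?_, ?_, ?_⟩
  · intro p hp
    simpa using hm hp
  · intro p hp
    simpa using hl p hp
  · intro p hp
    simp only [hr _ hp]
    simp
  · intro p hp
    have h1 := hdet p hp
    have hd : HasFDerivAt s (fderiv ℝ s p) p :=
      ((hs.contDiffAt (hU.mem_nhds hp)).differentiableAt (by simp)).hasFDerivAt
    have h2 : HasFDerivAt (fun p => (-(s p).2, (s p).1)) _ p := hd.snd.neg.prodMk hd.fst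
    rw [h2.fderiv, det2]
    rw [det2] at h1
    simp
    linarith
  · rw [Matrix.transpose_mul, Matrix.mul_assoc, ← Matrix.mul_assoc A, hA, Matrix.one_mul, hDD]
  · rw [Matrix.det_mul, hDdet, hA1, one_mul]
  · intro p hp
    rw [← Matrix.mulVec_mulVec, hnf _ hp, hD]
    ext i
    rw [Matrix.mulVec_diagonal]
    fin_cases i <;> simp [NF, BC] <;> ring

theorem pd_lead (g : ℝ → ℝ) (w : ℝ → ℝ) (P : ℝ → ℝ) (hP : ContDiff ℝ (⊤ : ℕ∞) P)
    (hw : ContinuousAt w 0) (hg : ∀ᶠ t in 𝓝 (0:ℝ), g t = t ^ 2 * P t)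
    (hgw : ∀ᶠ t in 𝓝 (0:ℝ), HasDerivAt g (t * w t) t) : 2 * P 0 = w 0 := by
  have hdP : ContDiff ℝ (⊤ : ℕ∞) (deriv P) := (contDiff_infty_iff_deriv.1 hP).2
  have := cont_lim (fun t => 2 * P t + t * deriv P t) w
    ((continuous_const.mul hP.continuous).add (continuous_id.mul hdP.continuous)) hw ?_
  · simpa using this
  · filter_upwards [hg.eventually_nhds, hgw] with t h1 h2 ht
    have h3 : HasDerivAt (fun t => t ^ 2 * P t) (t * w t) t :=
      h2.congr_of_eventuallyEq (h1.mono fun x hx => hx.symm)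
    have h4 := (hasDerivAt_pow 2 t).mul (hP.differentiable (by simp) t).hasDerivAt
    have h5 := h3.unique h4
    apply mul_left_cancel₀ ht
    rw [h5]; push_cast; ring

theorem base (f φ₁ φ₂ : ℝ × ℝ → Fin 3 → ℝ) (W : Set (ℝ × ℝ))
    (hW : IsOpen W) (hW0 : (0 : ℝ × ℝ) ∈ W)
    (hf : ContDiffOn ℝ (⊤ : ℕ∞) f W) (hf0 : f 0 = 0)
    (hφ₁ : ContDiffOn ℝ (⊤ : ℕ∞) φ₁ W) (hφ₂ : ContDiffOn ℝ (⊤ : ℕ∞) φ₂ W)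
    (hfu : ∀ p ∈ W, pd1 f p = p.1 • φ₁ p)
    (hfv : ∀ p ∈ W, pd2 f p = p.2 • φ₂ p)
    (hli : LinearIndependent ℝ ![φ₁ 0, φ₂ 0]) : ∃ x y, GoodNF f x y := by
  obtain ⟨A, a, ha, hA, hA1, hp0, hq0, hp2, hq2, hp1, hq1⟩ := frame_exists _ _ hli
  have lin : ∀ i, ∃ L : (Fin 3 → ℝ) →L[ℝ] ℝ, ∀ z, L z = A.mulVec z i := fun i =>
    ⟨LinearMap.toContinuousLinearMap ((LinearMap.proj i).comp A.mulVecLin), fun z => by simp⟩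
  choose L hL using lin
  set F : Fin 3 → ℝ × ℝ → ℝ := fun i p => L i (f p) with hFd
  have hF : ∀ i, ContDiffOn ℝ (⊤ : ℕ∞) (F i) W := fun i => (L i).contDiff.comp_contDiffOn hf
  have hF0 : ∀ i, F i 0 = 0 := fun i => by simp [hFd, hf0]
  have hfd : ∀ p ∈ W, DifferentiableAt ℝ f p := fun p hp =>
    (hf.contDiffAt (hW.mem_nhds hp)).differentiableAt (by simp)
  have hd1 : ∀ i u v, (u, v) ∈ W → HasDerivAt (fun t => F i (t, v)) (u * L i (φ₁ (u, v))) u := by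
    intro i u v h
    have h1 : DifferentiableAt ℝ (fun t => f (t, v)) u :=
      DifferentiableAt.comp u (hfd (u, v) h) (by fun_prop : DifferentiableAt ℝ (fun t : ℝ => (t, v)) u)
    have h2 := h1.hasDerivAt
    have h3 : deriv (fun t => f (t, v)) u = u • φ₁ (u, v) := hfu _ h
    rw [h3] at h2
    have h4 := (L i).hasFDerivAt.comp_hasDerivAt u h2
    rw [map_smul] at h4
    exact h4
  have hd2 : ∀ i u v, (u, v) ∈ W → HasDerivAt (fun t => F i (u, t)) (v * L i (φ₂ (u, v))) v := by
    intro i u v h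
    have h1 : DifferentiableAt ℝ (fun t => f (u, t)) v :=
      DifferentiableAt.comp v (hfd (u, v) h) (by fun_prop : DifferentiableAt ℝ (fun t : ℝ => (u, t)) v)
    have h2 := h1.hasDerivAt
    have h3 : deriv (fun t => f (u, t)) v = v • φ₂ (u, v) := hfv _ h
    rw [h3] at h2
    have h4 := (L i).hasFDerivAt.comp_hasDerivAt v h2
    rw [map_smul] at h4
    exact h4
  have hz1 : ∀ i v, ((0:ℝ), v) ∈ W → HasDerivAt (fun t => F i (t, v)) 0 0 := fun i v h => by
    simpa using hd1 i 0 v h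
  have hz2 : ∀ i u, (u, (0:ℝ)) ∈ W → HasDerivAt (fun t => F i (u, t)) 0 0 := fun i u h => by
    simpa using hd2 i u 0 h
  choose P Q R hP hQ hR hE using fun i =>
    struct_lem (F i) W hW hW0 (hF i) (hF0 i) (hz1 i) (hz2 i)
  have hc1 : Tendsto (fun t : ℝ => (t, (0:ℝ))) (𝓝 0) (𝓝 (0 : ℝ × ℝ)) :=
    (by fun_prop : ContinuousAt (fun t : ℝ => (t, (0:ℝ))) 0).tendsto
  have hc2 : Tendsto (fun t : ℝ => ((0:ℝ), t)) (𝓝 0) (𝓝 (0 : ℝ × ℝ)) :=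
    (by fun_prop : ContinuousAt (fun t : ℝ => ((0:ℝ), t)) 0).tendsto
  have lP : ∀ i, 2 * P i 0 = A.mulVec (φ₁ 0) i := by
    intro i
    rw [← hL]
    refine pd_lead (fun t => F i (t, 0)) (fun t => L i (φ₁ (t, 0))) (P i) (hP i) ?_ ?_ ?_
    · have : ContinuousAt φ₁ ((0:ℝ), (0:ℝ)) := (hφ₁.contDiffAt (hW.mem_nhds hW0)).continuousAt
      exact (L i).continuous.continuousAt.comp
        (ContinuousAt.comp (f := fun t : ℝ => (t, (0:ℝ))) this (by fun_prop))
    · filter_upwards [hc1.eventually (hE i)] with t ht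
      simpa using ht
    · filter_upwards [hc1.eventually (hW.mem_nhds hW0)] with t ht
      exact hd1 i t 0 ht
  have lQ : ∀ i, 2 * Q i 0 = A.mulVec (φ₂ 0) i := by
    intro i
    rw [← hL]
    refine pd_lead (fun t => F i (0, t)) (fun t => L i (φ₂ (0, t))) (Q i) (hQ i) ?_ ?_ ?_
    · have : ContinuousAt φ₂ ((0:ℝ), (0:ℝ)) := (hφ₂.contDiffAt (hW.mem_nhds hW0)).continuousAt
      exact (L i).continuous.continuousAt.comp
        (ContinuousAt.comp (f := fun t : ℝ => ((0:ℝ), t)) this (by fun_prop))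
    · filter_upwards [hc2.eventually (hE i)] with t ht
      simpa using ht
    · filter_upwards [hc2.eventually (hW.mem_nhds hW0)] with t ht
      exact hd2 i 0 t ht
  have hP0 : 0 < P 0 0 := by linarith [lP 0]
  have hQ0 : Q 0 0 < 0 := by linarith [lQ 0]
  obtain ⟨N, hNsub, hN, hN0⟩ := mem_nhds_iff.1 ((hE 0).and (hW.mem_nhds hW0))
  obtain ⟨U, V, sInv, hU, hV, hU0, hV0, hUN, hs, hsI, hm, hmI, hl, hr, hdet, hpos⟩ :=
    straighten (P 0) (Q 0) (R 0) (hP 0) (hQ 0) (hR 0) hP0 hQ0 N hN hN0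
  have hUW : U ⊆ W := fun p hp => (hNsub (hUN hp)).2
  choose P' Q' R' hP' hQ' hR' lP' lQ' hE' using fun i =>
    comp_lem (P 0) (Q 0) (R 0) (hP 0) (hQ 0) (hR 0) U V sInv hU hV hU0 hV0 hsI hm hs hmI hl hr hpos
      (F i) ((hF i).mono hUW) (hF0 i) (fun v h => hz1 i v (hUW h)) (fun u h => hz2 i u (hUW h))
      (P i) (Q i) (R i) (hP i).continuous (hQ i).continuous (hE i)
  have pa : P' 1 0 = a := by
    apply mul_left_cancel₀ hP0.ne'
    rw [← lP' 1]; linear_combination (lP 1 + hp1 - a * lP 0) / 2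
  have qa : Q' 1 0 = a := by
    apply mul_left_cancel₀ (neg_pos.2 hQ0).ne'
    rw [← lQ' 1]; linear_combination (lQ 1 + hq1 + a * lQ 0) / 2
  have pz : P' 2 0 = 0 := by
    apply mul_left_cancel₀ hP0.ne'
    rw [← lP' 2]; linarith [lP 2]
  have qz : Q' 2 0 = 0 := by
    apply mul_left_cancel₀ (neg_pos.2 hQ0).ne'
    rw [← lQ' 2]; linarith [lQ 2]
  obtain ⟨b1, hb1, eb1⟩ := had0 (P' 1) (hP' 1)
  obtain ⟨b3, hb3, eb3⟩ := had0 (Q' 1) (hQ' 1)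
  obtain ⟨c1, hc1, ec1⟩ := had0 (P' 2) (hP' 2)
  obtain ⟨c3, hc3, ec3⟩ := had0 (Q' 2) (hQ' 2)
  obtain ⟨M, hMsub, hM, hM0⟩ := mem_nhds_iff.1 ((hE' 1).and (hE' 2))
  have hs0 : sS (P 0) (Q 0) (R 0) 0 = 0 := by simp [sS]
  refine ⟨c1 0, c3 0, a, b1, b3, c1, c3, R' 1, R' 2, U ∩ sS (P 0) (Q 0) (R 0) ⁻¹' M, V ∩ M,
    sS (P 0) (Q 0) (R 0), sInv, A, ha, hb1, hb3, hc1, hc3, rfl, rfl, hR' 1, hR' 2,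
    hs.continuousOn.isOpen_inter_preimage hU hM, hV.inter hM, ⟨hU0, by simpa [hs0] using hM0⟩,
    ⟨hV0, hM0⟩, hs.mono Set.inter_subset_left, hsI.mono Set.inter_subset_left, hs0,
    fun p hp => ⟨hm hp.1, hp.2⟩, fun p hp => ⟨hmI hp.1, ?_⟩, fun p hp => hl p hp.1,
    fun p hp => hr p hp.1, fun p hp => hdet p hp.1, hA, hA1, ?_⟩
  · rw [Set.mem_preimage, hr p hp.1]; exact hp.2
  · intro p hp
    have hq := hmI hp.1
    have h0 := (hNsub (hUN hq)).1
    obtain ⟨h1, h2⟩ := hMsub hp.2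
    have hsp := hr p hp.1
    have hps := hpos _ hq
    ext i
    rw [← hL]
    fin_cases i
    · show F 0 (sInv p) = p.1 ^ 2 - p.2 ^ 2
      rw [h0]
      have k1 : (sInv p).1 * √(P 0 (sInv p).1 + (sInv p).2 ^ 2 * R 0 (sInv p)) = p.1 :=
        congrArg Prod.fst hsp
      have k2 : (sInv p).2 * √(-Q 0 (sInv p).2) = p.2 := congrArg Prod.snd hsp
      rw [← k1, ← k2, mul_pow, mul_pow, Real.sq_sqrt hps.1.le, Real.sq_sqrt hps.2.le]
      ring
    · show F 1 (sInv p) = a * (p.1 ^ 2 + p.2 ^ 2) + BC b1 b3 (R' 1) p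
      rw [h1, eb1, eb3, pa, qa, BC]; ring
    · show F 2 (sInv p) = BC c1 c3 (R' 2) p
      rw [h2, ec1, ec3, pz, qz, BC]; ring

/-- existence of the `SO(3)`-normal form of a `D₄⁺`-type singular point. -/
theorem stmt_0 (f φ₁ φ₂ : ℝ × ℝ → Fin 3 → ℝ) (W : Set (ℝ × ℝ))
    (hW : IsOpen W) (hW0 : (0 : ℝ × ℝ) ∈ W)
    (hf : ContDiffOn ℝ (⊤ : ℕ∞) f W) (hf0 : f 0 = 0)
    (hφ₁ : ContDiffOn ℝ (⊤ : ℕ∞) φ₁ W) (hφ₂ : ContDiffOn ℝ (⊤ : ℕ∞) φ₂ W)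
    (hfu : ∀ p ∈ W, pd1 f p = p.1 • φ₁ p)
    (hfv : ∀ p ∈ W, pd2 f p = p.2 • φ₂ p)
    (hli : LinearIndependent ℝ ![φ₁ 0, φ₂ 0]) :
    ∃ (a : ℝ) (b1 b3 c1 c3 : ℝ → ℝ) (b2 c2 : ℝ × ℝ → ℝ) (U V : Set (ℝ × ℝ))
      (s sInv : ℝ × ℝ → ℝ × ℝ) (A : Matrix (Fin 3) (Fin 3) ℝ),
      0 ≤ a ∧
      ContDiff ℝ (⊤ : ℕ∞) b1 ∧ ContDiff ℝ (⊤ : ℕ∞) b3 ∧ ContDiff ℝ (⊤ : ℕ∞) c1 ∧ ContDiff ℝ (⊤ : ℕ∞) c3 ∧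
      0 ≤ c1 0 ∧ 0 ≤ c3 0 ∧ ContDiff ℝ (⊤ : ℕ∞) b2 ∧ ContDiff ℝ (⊤ : ℕ∞) c2 ∧
      IsOpen U ∧ IsOpen V ∧ (0 : ℝ × ℝ) ∈ U ∧ (0 : ℝ × ℝ) ∈ V ∧
      ContDiffOn ℝ (⊤ : ℕ∞) s U ∧ ContDiffOn ℝ (⊤ : ℕ∞) sInv V ∧ s 0 = 0 ∧
      Set.MapsTo s U V ∧ Set.MapsTo sInv V U ∧
      (∀ p ∈ U, sInv (s p) = p) ∧ (∀ p ∈ V, s (sInv p) = p) ∧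
      (∀ p ∈ U, 0 < LinearMap.det ((fderiv ℝ s p).toLinearMap)) ∧
      A * A.transpose = 1 ∧ A.det = 1 ∧
      (∀ p ∈ V, A.mulVec (f (sInv p)) = NF a b1 b3 c1 c3 b2 c2 p) := by
  obtain ⟨x, y, h⟩ := base f φ₁ φ₂ W hW hW0 hf hf0 hφ₁ hφ₂ hfu hfv hli
  obtain ⟨x, y, hx, hy, h⟩ : ∃ x y : ℝ, 0 ≤ x ∧ 0 ≤ y ∧ GoodNF f x y := by
    rcases le_total 0 x with hx | hx <;> rcases le_total 0 y with hy | hy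
    · exact ⟨_, _, hx, hy, h⟩
    · exact ⟨_, _, by linarith, by linarith, h.rot.rot.rot⟩
    · exact ⟨_, _, hy, by linarith, h.rot⟩
    · exact ⟨_, _, by linarith, by linarith, h.rot.rot⟩
  obtain ⟨a, b1, b3, c1, c3, b2, c2, U, V, s, sInv, A, h1, h2, h3, h4, h5, h6, h7, h8⟩ := h
  exact ⟨a, b1, b3, c1, c3, b2, c2, U, V, s, sInv, A, h1, h2, h3, h4, h5, h6 ▸ hx, h7 ▸ hy, h8⟩
end
end

section
/- Fix the D₄⁺ normal form f with a > 0, c₁(0) > 0 and c₃(0) > 0. Suppose A ∈ SO(3) and s is a C^∞ diffeomorphism between open neighborhoods of the origin in ℝ² with s(0,0) = (0,0) and det(Ds) > 0, such that A·f(s⁻¹(u,v)) = f(u,v) for all (u,v) in a neighborhood of the origin. Then A is the identity matrix and s is infinitely tangent to the identity at the origin: every partial derivative of every order of the map (u,v) ↦ s(u,v) − (u,v) vanishes at (0,0). -/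
open Real Filter Topology

noncomputable section

/-- order-`k` smallness together with the matching Lipschitz bound near the origin -/
def PP (k : ℕ) (g : ℝ × ℝ → ℝ) : Prop :=
  ∃ C : ℝ, 0 ≤ C ∧ ∃ ρ : ℝ, 0 < ρ ∧ ∀ r : ℝ, 0 < r → r < ρ → ∀ p q : ℝ × ℝ, ‖p‖ ≤ r → ‖q‖ ≤ r →
    |g p| ≤ C * r ^ k ∧ |g p - g q| * r ≤ C * r ^ k * ‖p - q‖

theorem PP_mul {k l : ℕ} {g h : ℝ × ℝ → ℝ} (hg : PP k g) (hh : PP l h) :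
    PP (k + l) (fun p => g p * h p) := by
  obtain ⟨C, hC, ρ, hρ, H⟩ := hg
  obtain ⟨D, hD, σ, hσ, K⟩ := hh
  refine ⟨2 * C * D, by positivity, min ρ σ, lt_min hρ hσ, ?_⟩
  intro r hr hrm p q hp hq
  obtain ⟨h1, h2⟩ := H r hr (lt_of_lt_of_le hrm (min_le_left _ _)) p q hp hq
  obtain ⟨h3, h4⟩ := K r hr (lt_of_lt_of_le hrm (min_le_right _ _)) p q hp hq
  obtain ⟨h5, -⟩ := K r hr (lt_of_lt_of_le hrm (min_le_right _ _)) q q hq hq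
  have hX : 0 ≤ C * r ^ k := by positivity
  have hY : 0 ≤ D * r ^ l := by positivity
  have e1 : |g p| * |h p| ≤ (C * r ^ k) * (D * r ^ l) :=
    mul_le_mul h1 h3 (abs_nonneg _) hX
  constructor
  · rw [abs_mul, pow_add]
    nlinarith [mul_nonneg hX hY]
  · have e2 : |g p * h p - g q * h q| ≤ |g p| * |h p - h q| + |g p - g q| * |h q| := by
      rw [← abs_mul, ← abs_mul]
      refine le_trans (le_of_eq ?_) (abs_add_le _ _)
      congr 1; ring
    have e3 : |g p| * (|h p - h q| * r) ≤ (C * r ^ k) * (D * r ^ l * ‖p - q‖) :=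
      mul_le_mul h1 h4 (by positivity) hX
    have e4 : (|g p - g q| * r) * |h q| ≤ (C * r ^ k * ‖p - q‖) * (D * r ^ l) :=
      mul_le_mul h2 h5 (by positivity) (by positivity)
    have e5 := mul_le_mul_of_nonneg_right e2 hr.le
    rw [pow_add]
    nlinarith

theorem PP_add {k : ℕ} {g h : ℝ × ℝ → ℝ} (hg : PP k g) (hh : PP k h) :
    PP k (fun p => g p + h p) := by
  obtain ⟨C, hC, ρ, hρ, H⟩ := hg
  obtain ⟨D, hD, σ, hσ, K⟩ := hh
  refine ⟨C + D, by positivity, min ρ σ, lt_min hρ hσ, ?_⟩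
  intro r hr hrm p q hp hq
  obtain ⟨h1, h2⟩ := H r hr (lt_of_lt_of_le hrm (min_le_left _ _)) p q hp hq
  obtain ⟨h3, h4⟩ := K r hr (lt_of_lt_of_le hrm (min_le_right _ _)) p q hp hq
  constructor
  · have := abs_add_le (g p) (h p)
    nlinarith
  · have e : |g p + h p - (g q + h q)| ≤ |g p - g q| + |h p - h q| := by
      refine le_trans (le_of_eq ?_) (abs_add_le _ _)
      congr 1; ring
    have := mul_le_mul_of_nonneg_right e hr.le
    nlinarith

theorem PP_succ {k : ℕ} {g : ℝ × ℝ → ℝ} (hg : PP (k + 1) g) : PP k g := by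
  obtain ⟨C, hC, ρ, hρ, H⟩ := hg
  refine ⟨C, hC, min ρ 1, lt_min hρ one_pos, ?_⟩
  intro r hr hrm p q hp hq
  obtain ⟨h1, h2⟩ := H r hr (lt_of_lt_of_le hrm (min_le_left _ _)) p q hp hq
  have hr1 : r ≤ 1 := (lt_of_lt_of_le hrm (min_le_right _ _)).le
  have e : C * r ^ (k + 1) ≤ C * r ^ k :=
    mul_le_mul_of_nonneg_left (pow_le_pow_of_le_one hr.le hr1 (Nat.le_succ k)) hC
  exact ⟨h1.trans e, h2.trans (mul_le_mul_of_nonneg_right e (norm_nonneg _))⟩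

theorem PP_fst : PP 1 (fun p => p.1) := by
  refine ⟨1, zero_le_one, 1, one_pos, ?_⟩
  intro r hr _ p q hp hq
  have h1 : |p.1| ≤ ‖p‖ := norm_fst_le p
  have h2 : |p.1 - q.1| ≤ ‖p - q‖ := norm_fst_le (p - q)
  constructor
  · simpa using h1.trans hp
  · nlinarith

theorem PP_snd : PP 1 (fun p => p.2) := by
  refine ⟨1, zero_le_one, 1, one_pos, ?_⟩
  intro r hr _ p q hp hq
  have h1 : |p.2| ≤ ‖p‖ := norm_snd_le p
  have h2 : |p.2 - q.2| ≤ ‖p - q‖ := norm_snd_le (p - q)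
  constructor
  · simpa using h1.trans hp
  · nlinarith

theorem PP_smooth {g : ℝ × ℝ → ℝ} (hg : ContDiff ℝ (⊤ : ℕ∞) g) : PP 0 g := by
  have hg1 : ContDiffAt ℝ 1 g 0 := hg.contDiffAt.of_le (by exact_mod_cast le_top)
  obtain ⟨K, t, ht, hK⟩ := hg1.exists_lipschitzOnWith
  obtain ⟨ε, hε, hεt⟩ := Metric.mem_nhds_iff.1 ht
  refine ⟨|g 0| + K, by positivity, min ε 1, lt_min hε one_pos, ?_⟩
  intro r hr hrm p q hp hq
  have hrε := lt_of_lt_of_le hrm (min_le_left _ _)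
  have hr1 := lt_of_lt_of_le hrm (min_le_right _ _)
  have mem : ∀ x : ℝ × ℝ, ‖x‖ ≤ r → x ∈ t := fun x hx =>
    hεt (by simpa using lt_of_le_of_lt hx hrε)
  have key : ∀ x y : ℝ × ℝ, ‖x‖ ≤ r → ‖y‖ ≤ r → |g x - g y| ≤ K * ‖x - y‖ := by
    intro x y hx hy
    have := hK.dist_le_mul x (mem x hx) y (mem y hy)
    rwa [Real.dist_eq, dist_eq_norm] at this
  have hK0 : (0:ℝ) ≤ K := K.2
  constructor
  · have h := key p 0 hp (by simpa using hr.le)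
    rw [sub_zero] at h
    have h' : |g p| ≤ |g 0| + |g p - g 0| := by
      refine le_trans (le_of_eq ?_) (abs_add_le _ _)
      congr 1; ring
    have : (K:ℝ) * ‖p‖ ≤ K * 1 := mul_le_mul_of_nonneg_left (hp.trans hr1.le) hK0
    simp only [pow_zero, mul_one]
    linarith
  · have h := key p q hp hq
    have e1 : |g p - g q| * r ≤ |g p - g q| * 1 :=
      mul_le_mul_of_nonneg_left hr1.le (abs_nonneg _)
    have e2 : 0 ≤ |g 0| * ‖p - q‖ := by positivity
    simp only [pow_zero, mul_one]
    nlinarith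

theorem PP_BC {g1 g3 : ℝ → ℝ} {g2 : ℝ × ℝ → ℝ} (h1 : ContDiff ℝ (⊤ : ℕ∞) g1)
    (h3 : ContDiff ℝ (⊤ : ℕ∞) g3) (h2 : ContDiff ℝ (⊤ : ℕ∞) g2) : PP 3 (BC g1 g3 g2) := by
  have a1 := PP_mul (PP_mul (PP_mul PP_fst PP_fst) PP_fst) (PP_smooth (h1.comp contDiff_fst))
  have a3 := PP_mul (PP_mul (PP_mul PP_snd PP_snd) PP_snd) (PP_smooth (h3.comp contDiff_snd))
  have a2' := PP_mul (PP_mul (PP_mul PP_fst PP_fst) (PP_mul PP_snd PP_snd)) (PP_smooth h2)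
  have a2 := PP_succ (k := 3) a2'
  have := PP_add (PP_add a1 a2) a3
  convert this using 1
  funext p
  simp only [BC, Function.comp]
  ring

/-- rescaled building block -/
def F3 (g1 g3 : ℝ → ℝ) (g2 : ℝ × ℝ → ℝ) (t : ℝ) (q : ℝ × ℝ) : ℝ :=
  q.1 ^ 3 * g1 (t * q.1) + t * (q.1 ^ 2 * q.2 ^ 2 * g2 (t * q.1, t * q.2)) + q.2 ^ 3 * g3 (t * q.2)

theorem BC_eq (g1 g3 : ℝ → ℝ) (g2 : ℝ × ℝ → ℝ) (t : ℝ) (q : ℝ × ℝ) :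
    BC g1 g3 g2 (t • q) = t ^ 3 * F3 g1 g3 g2 t q := by
  have : t • q = (t * q.1, t * q.2) := rfl
  rw [this]
  simp only [BC, F3]
  ring

theorem F3_tendsto {g1 g3 : ℝ → ℝ} {g2 : ℝ × ℝ → ℝ} (h1 : Continuous g1)
    (h3 : Continuous g3) (h2 : Continuous g2) {Q : ℝ → ℝ × ℝ} {q : ℝ × ℝ}
    (hQ : Tendsto Q (𝓝[≠] 0) (𝓝 q)) :
    Tendsto (fun t => F3 g1 g3 g2 t (Q t)) (𝓝[≠] 0) (𝓝 (q.1 ^ 3 * g1 0 + q.2 ^ 3 * g3 0)) := by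
  have hc : Continuous (fun x : ℝ × (ℝ × ℝ) => F3 g1 g3 g2 x.1 x.2) := by
    unfold F3; fun_prop
  have ht : Tendsto (fun t : ℝ => (t, Q t)) (𝓝[≠] 0) (𝓝 (0, q)) :=
    (tendsto_id.mono_left nhdsWithin_le_nhds).prodMk_nhds hQ
  have := (hc.tendsto (0, q)).comp ht
  simpa [F3, Function.comp_def] using this

theorem ray_tendsto {s : ℝ × ℝ → ℝ × ℝ} {L : ℝ × ℝ →L[ℝ] ℝ × ℝ} (hs : HasFDerivAt s L 0)
    (hs0 : s 0 = 0) (p : ℝ × ℝ) :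
    Tendsto (fun t : ℝ => t⁻¹ • s (t • p)) (𝓝[≠] 0) (𝓝 (L p)) := by
  have h1 : HasDerivAt (fun t : ℝ => t • p) p 0 := by
    simpa using (hasDerivAt_id (0:ℝ)).smul_const p
  have hs' : HasFDerivAt s L ((0:ℝ) • p) := by simpa using hs
  have h2 := hs'.comp_hasDerivAt (0:ℝ) h1
  have := hasDerivAt_iff_tendsto_slope_zero.1 h2
  simpa [hs0] using this

theorem lin_case {a α β γ δ k1 k3 : ℝ} (ha : 0 < a) (hk1 : 0 < k1) (hk3 : 0 < k3)
    (A : Matrix (Fin 3) (Fin 3) ℝ) (hA : A * A.transpose = 1) (hAdet : A.det = 1)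
    (hd : 0 < α * δ - β * γ)
    (H : ∀ x y : ℝ, A.mulVec ![x ^ 2 - y ^ 2, a * (x ^ 2 + y ^ 2), 0] =
      ![(α * x + β * y) ^ 2 - (γ * x + δ * y) ^ 2,
        a * ((α * x + β * y) ^ 2 + (γ * x + δ * y) ^ 2), 0])
    (H3 : A 2 0 = 0 → A 2 1 = 0 → ∀ x y : ℝ, A 2 2 * (x ^ 3 * k1 + y ^ 3 * k3) =
      (α * x + β * y) ^ 3 * k1 + (γ * x + δ * y) ^ 3 * k3) :
    A = 1 ∧ α = 1 ∧ β = 0 ∧ γ = 0 ∧ δ = 1 := by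
  have hA' : A.transpose * A = 1 := mul_eq_one_comm.1 hA
  have o00 := congrFun (congrFun hA' 0) 0
  have o01 := congrFun (congrFun hA' 0) 1
  have o11 := congrFun (congrFun hA' 1) 1
  have r22 := congrFun (congrFun hA 2) 2
  have r00 := congrFun (congrFun hA 0) 0
  have r11 := congrFun (congrFun hA 1) 1
  have E1 := H 1 0
  have E2 := H 0 1
  have E3 := H 1 1
  have p0 := congrFun E1 0
  have p1 := congrFun E1 1
  have p2 := congrFun E1 2
  have q0 := congrFun E2 0
  have q1 := congrFun E2 1
  have q2 := congrFun E2 2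
  have w0 := congrFun E3 0
  have w1 := congrFun E3 1
  rw [Matrix.det_fin_three] at hAdet
  simp [Matrix.mul_apply, Matrix.mulVec, dotProduct, Fin.sum_univ_three] at o00 o01 o11 r22 r00 r11 p0 p1 p2 q0 q1 q2 w0 w1
  have a20 : A 2 0 = 0 := by linarith
  have a21 : A 2 1 = 0 := by
    have : A 2 1 * a = 0 := by linarith
    exact (mul_eq_zero.1 this).resolve_right ha.ne'
  have c1 : α * β - γ * δ = 0 := by linear_combination (p0 + q0 - w0) / 2
  have c2 : α * β + γ * δ = 0 := by
    have : a * (α * β + γ * δ) = 0 := by linear_combination (p1 + q1 - w1) / 2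
    exact (mul_eq_zero.1 this).resolve_left ha.ne'
  have d1 : α * β = 0 := by linarith
  have d2 : γ * δ = 0 := by linarith
  have T := H3 a20 a21
  have T1 := T 1 0
  have T2 := T 0 1
  simp at T1 T2
  have pos : 0 < 1 + a ^ 2 := by positivity
  -- isometry on the two generating vectors
  have n1 : (α ^ 2 - γ ^ 2) ^ 2 + a ^ 2 * (α ^ 2 + γ ^ 2) ^ 2 = 1 + a ^ 2 := by
    have : (A 0 0 + A 0 1 * a) ^ 2 + (A 1 0 + A 1 1 * a) ^ 2 + (A 2 0 + A 2 1 * a) ^ 2 = 1 + a ^ 2 := by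
      linear_combination o00 + 2 * a * o01 + a ^ 2 * o11
    rw [p0, p1, p2] at this
    linear_combination this
  have n2 : (β ^ 2 - δ ^ 2) ^ 2 + a ^ 2 * (β ^ 2 + δ ^ 2) ^ 2 = 1 + a ^ 2 := by
    have : (-A 0 0 + A 0 1 * a) ^ 2 + (-A 1 0 + A 1 1 * a) ^ 2 + (-A 2 0 + A 2 1 * a) ^ 2 = 1 + a ^ 2 := by
      linear_combination o00 - 2 * a * o01 + a ^ 2 * o11
    rw [q0, q1, q2] at this
    linear_combination this
  have sq1 : ∀ x : ℝ, (x ^ 2) ^ 2 * (1 + a ^ 2) = 1 + a ^ 2 → x ^ 2 = 1 := by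
    intro x hx
    have : (x ^ 2) ^ 2 = 1 := by
      have : ((x ^ 2) ^ 2 - 1) * (1 + a ^ 2) = 0 := by linarith
      have := (mul_eq_zero.1 this).resolve_right pos.ne'
      linarith
    exact (pow_eq_one_iff_of_nonneg (sq_nonneg x) two_ne_zero).1 this
  by_cases hα : α = 0
  · exfalso
    subst hα
    have hβγ : β * γ < 0 := by linarith
    have hγ : γ ≠ 0 := by rintro rfl; simp at hβγ
    have hδ : δ = 0 := (mul_eq_zero.1 d2).resolve_left hγ
    subst hδ
    have g2 : γ ^ 2 = 1 := sq1 γ (by linear_combination n1)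
    have b2 : β ^ 2 = 1 := sq1 β (by linear_combination n2)
    rw [b2] at q0 q1
    rw [g2] at p0 p1
    have a00 : A 0 0 = -1 := by linarith
    have a10 : A 1 0 = 0 := by linarith
    have a01 : A 0 1 = 0 := by
      have : A 0 1 * a = 0 := by linarith
      exact (mul_eq_zero.1 this).resolve_right ha.ne'
    have a11 : A 1 1 = 1 := by
      have : (A 1 1 - 1) * a = 0 := by linarith
      have := (mul_eq_zero.1 this).resolve_right ha.ne'
      linarith
    rw [a00, a01, a10, a11, a20, a21] at hAdet
    have a22 : A 2 2 = -1 := by linarith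
    rw [a22] at T1 T2
    have g3 : γ ^ 3 = γ := by linear_combination γ * g2
    have b3 : β ^ 3 = β := by linear_combination β * b2
    simp at T1 T2
    rw [g3] at T1
    rw [b3] at T2
    have hγn : γ < 0 := by
      by_contra h
      have := mul_nonneg (not_lt.1 h) hk3.le
      linarith
    have hβn : β < 0 := by
      by_contra h
      have := mul_nonneg (not_lt.1 h) hk1.le
      linarith
    have := mul_pos_of_neg_of_neg hβn hγn
    linarith
  · have hβ : β = 0 := (mul_eq_zero.1 d1).resolve_left hα
    subst hβ
    have hδ : δ ≠ 0 := by rintro rfl; simp at hd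
    have hγ : γ = 0 := (mul_eq_zero.1 d2).resolve_right hδ
    subst hγ
    have g2 : α ^ 2 = 1 := sq1 α (by linear_combination n1)
    have b2 : δ ^ 2 = 1 := sq1 δ (by linear_combination n2)
    rw [b2] at q0 q1
    rw [g2] at p0 p1
    have a00 : A 0 0 = 1 := by linarith
    have a10 : A 1 0 = 0 := by linarith
    have a01 : A 0 1 = 0 := by
      have : A 0 1 * a = 0 := by linarith
      exact (mul_eq_zero.1 this).resolve_right ha.ne'
    have a11 : A 1 1 = 1 := by
      have : (A 1 1 - 1) * a = 0 := by linarith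
      have := (mul_eq_zero.1 this).resolve_right ha.ne'
      linarith
    rw [a00, a01, a10, a11, a20, a21] at hAdet
    have a22 : A 2 2 = 1 := by linarith
    have a02 : A 0 2 = 0 := by rw [a00, a01] at r00; exact mul_self_eq_zero.1 (by linarith)
    have a12 : A 1 2 = 0 := by rw [a10, a11] at r11; exact mul_self_eq_zero.1 (by linarith)
    rw [a22] at T1 T2
    have g3 : α ^ 3 = α := by linear_combination α * g2
    have b3 : δ ^ 3 = δ := by linear_combination δ * b2
    simp only [zero_pow (three_ne_zero), zero_mul, add_zero, zero_add] at T1 T2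
    rw [g3] at T1
    rw [b3] at T2
    refine ⟨?_, (mul_right_cancel₀ hk1.ne' T1).symm, rfl, rfl, (mul_right_cancel₀ hk3.ne' T2).symm⟩
    ext i j
    fin_cases i <;> fin_cases j <;> simp [*]

theorem flat_of_cone {h : ℝ × ℝ → ℝ × ℝ} (hh : ContDiffAt ℝ (⊤ : ℕ∞) h 0) {ρ : ℝ} (hρ : 0 < ρ)
    (H : ∀ p : ℝ × ℝ, ‖p‖ < ρ → |p.1| < 2 * |p.2| → |p.2| < 2 * |p.1| → h p = 0) (n : ℕ) :
    iteratedFDeriv ℝ n h 0 = 0 := by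
  have hc : ContinuousAt (iteratedFDeriv ℝ n h) 0 :=
    hh.continuousAt_iteratedFDeriv (by exact_mod_cast le_top)
  have ht : Tendsto (fun t : ℝ => ((t, t) : ℝ × ℝ)) (𝓝[>] 0) (𝓝 0) := by
    have : Continuous (fun t : ℝ => ((t, t) : ℝ × ℝ)) := by fun_prop
    exact (this.tendsto' 0 0 rfl).mono_left nhdsWithin_le_nhds
  have h1 := hc.tendsto.comp ht
  refine tendsto_nhds_unique h1 (tendsto_const_nhds.congr' ?_)
  filter_upwards [Ioo_mem_nhdsGT hρ] with t htm
  have hopen : IsOpen {p : ℝ × ℝ | ‖p‖ < ρ ∧ |p.1| < 2 * |p.2| ∧ |p.2| < 2 * |p.1|} := by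
    have o1 : IsOpen {p : ℝ × ℝ | ‖p‖ < ρ} := isOpen_lt (by fun_prop) (by fun_prop)
    have o2 : IsOpen {p : ℝ × ℝ | |p.1| < 2 * |p.2|} := isOpen_lt (by fun_prop) (by fun_prop)
    have o3 : IsOpen {p : ℝ × ℝ | |p.2| < 2 * |p.1|} := isOpen_lt (by fun_prop) (by fun_prop)
    exact o1.inter (o2.inter o3)
  have hmem : ((t, t) : ℝ × ℝ) ∈ {p : ℝ × ℝ | ‖p‖ < ρ ∧ |p.1| < 2 * |p.2| ∧ |p.2| < 2 * |p.1|} := by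
    have := htm.1
    have h2 := htm.2
    simp [Prod.norm_def, abs_of_pos this, h2, this]
  have hev : h =ᶠ[𝓝 (t, t)] fun _ => 0 := by
    filter_upwards [hopen.mem_nhds hmem] with p hp
    exact H p hp.1 hp.2.1 hp.2.2
  have := (hev.iteratedFDeriv ℝ n).eq_of_nhds
  simp only [Function.comp]
  rw [this]
  simp

theorem cone_zero {a C : ℝ} (ha : 0 < a) {u v u' v' N D b b' : ℝ} (hN : 0 < N)
    (hu : N / 2 ≤ |u|) (hv : N / 2 ≤ |v|) (hD : D ≤ N / 4)
    (hDu : |u' - u| ≤ D) (hDv : |v' - v| ≤ D) (hDm : D = |u' - u| ∨ D = |v' - v|)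
    (e1 : u' ^ 2 - v' ^ 2 = u ^ 2 - v ^ 2)
    (e2 : a * (u' ^ 2 + v' ^ 2) + b' = a * (u ^ 2 + v ^ 2) + b)
    (hb : |b' - b| ≤ C * N ^ 2 * D) (hCN : C * N < a / 2) : D = 0 := by
  have hD0 : 0 ≤ D := (abs_nonneg _).trans hDu
  have main : ∀ x x' : ℝ, N / 2 ≤ |x| → |x' - x| ≤ D → D = |x' - x| →
      2 * a * (x' ^ 2 - x ^ 2) = -(b' - b) → D = 0 := by
    intro x x' hx h1 h2 h3
    have h4 : N / 2 ≤ |x' + x| := by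
      have : |2 * x| ≤ |x' + x| + |x' - x| := by
        refine le_trans (le_of_eq ?_) (abs_sub _ _)
        congr 1; ring
      rw [abs_mul, abs_two] at this
      linarith
    have h5 : 2 * a * (|x' - x| * |x' + x|) = |b' - b| := by
      rw [← abs_neg (b' - b), ← h3, abs_mul, ← abs_mul, abs_of_pos (by positivity : 0 < 2 * a)]
      congr 2; ring
    rw [← h2] at h5
    have h6 : D * (N / 2) ≤ D * |x' + x| := mul_le_mul_of_nonneg_left h4 hD0
    have h7 : a * (D * N) ≤ C * N ^ 2 * D := by nlinarith
    by_contra hne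
    have hDp : 0 < D := lt_of_le_of_ne hD0 (Ne.symm hne)
    have h8 : 0 < D * N := by positivity
    nlinarith
  rcases hDm with h | h
  · exact main u u' hu hDu h (by linear_combination e2 + a * e1)
  · exact main v v' hv hDv h (by linear_combination e2 - a * e1)

/-- rigidity of the normal form: any `SO(3)`-symmetry fixing the normal form
is trivial to infinite order. -/
theorem stmt_1     (a : ℝ) (b1 b3 c1 c3 : ℝ → ℝ) (b2 c2 : ℝ × ℝ → ℝ)
    (hb1 : ContDiff ℝ (⊤ : ℕ∞) b1) (hb3 : ContDiff ℝ (⊤ : ℕ∞) b3)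
    (hc1s : ContDiff ℝ (⊤ : ℕ∞) c1) (hc3s : ContDiff ℝ (⊤ : ℕ∞) c3)
    (hb2 : ContDiff ℝ (⊤ : ℕ∞) b2) (hc2 : ContDiff ℝ (⊤ : ℕ∞) c2)
    (ha : 0 < a) (hc10 : 0 < c1 0) (hc30 : 0 < c3 0)
    (A : Matrix (Fin 3) (Fin 3) ℝ) (hA : A * A.transpose = 1) (hAdet : A.det = 1)
    (s sInv : ℝ × ℝ → ℝ × ℝ) (U V : Set (ℝ × ℝ))
    (hU : IsOpen U) (hV : IsOpen V) (hU0 : (0 : ℝ × ℝ) ∈ U) (hV0 : (0 : ℝ × ℝ) ∈ V)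
    (hs : ContDiffOn ℝ (⊤ : ℕ∞) s U) (hsInv : ContDiffOn ℝ (⊤ : ℕ∞) sInv V)
    (hmaps : Set.MapsTo s U V) (hmaps' : Set.MapsTo sInv V U)
    (hinv : ∀ p ∈ U, sInv (s p) = p) (hinv' : ∀ p ∈ V, s (sInv p) = p)
    (hs0 : s 0 = 0)
    (hdet : ∀ p ∈ U, 0 < LinearMap.det ((fderiv ℝ s p).toLinearMap))
    (heq : ∀ p ∈ V, A.mulVec (NF a b1 b3 c1 c3 b2 c2 (sInv p)) = NF a b1 b3 c1 c3 b2 c2 p) :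
    A = 1 ∧ ∀ n : ℕ, iteratedFDeriv ℝ n (fun p : ℝ × ℝ => s p - p) 0 = 0 := by
  have hUn : U ∈ 𝓝 (0 : ℝ × ℝ) := hU.mem_nhds hU0
  have hsm : ContDiffAt ℝ (⊤ : ℕ∞) s 0 := hs.contDiffAt hUn
  have hL : HasFDerivAt s (fderiv ℝ s 0) 0 :=
    (hsm.differentiableAt (by simp)).hasFDerivAt
  have hd0 := hdet 0 hU0
  generalize fderiv ℝ s 0 = L at hL hd0
  have heq' : ∀ p ∈ U, A.mulVec (NF a b1 b3 c1 c3 b2 c2 p) = NF a b1 b3 c1 c3 b2 c2 (s p) := by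
    intro p hp
    have := heq (s p) (hmaps hp)
    rwa [hinv p hp] at this
  obtain ⟨α, γ, h10⟩ : ∃ α γ, L (1, 0) = (α, γ) := ⟨_, _, rfl⟩
  obtain ⟨β, δ, h01⟩ : ∃ β δ, L (0, 1) = (β, δ) := ⟨_, _, rfl⟩
  have hLxy : ∀ x y : ℝ, L (x, y) = (α * x + β * y, γ * x + δ * y) := by
    intro x y
    have : ((x, y) : ℝ × ℝ) = x • (1, 0) + y • (0, 1) := by simp
    rw [this, map_add, map_smul, map_smul, h10, h01]
    ext <;> simp <;> ring
  have hd : 0 < α * δ - β * γ := by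
    rw [← LinearMap.det_toMatrix (Module.Basis.finTwoProd ℝ), Matrix.det_fin_two] at hd0
    simpa [LinearMap.toMatrix_apply, h10, h01] using hd0
  -- scaled equation
  have hscale : ∀ (x : ℝ × ℝ), ∀ᶠ t in 𝓝[≠] (0:ℝ), ∀ Q, Q = t⁻¹ • s (t • x) →
      A.mulVec ![x.1 ^ 2 - x.2 ^ 2, a * (x.1 ^ 2 + x.2 ^ 2) + t * F3 b1 b3 b2 t x,
        t * F3 c1 c3 c2 t x] =
      ![Q.1 ^ 2 - Q.2 ^ 2, a * (Q.1 ^ 2 + Q.2 ^ 2) + t * F3 b1 b3 b2 t Q,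
        t * F3 c1 c3 c2 t Q] := by
    intro x
    have hcont : Tendsto (fun t : ℝ => t • x) (𝓝[≠] 0) (𝓝 0) := by
      have : Continuous (fun t : ℝ => t • x) := by fun_prop
      exact (this.tendsto' 0 0 (by simp)).mono_left nhdsWithin_le_nhds
    filter_upwards [hcont hUn, self_mem_nhdsWithin] with t ht ht0 Q hQ
    have ht0 : t ≠ 0 := ht0
    have hsQ : s (t • x) = t • Q := by rw [hQ, smul_inv_smul₀ ht0]
    have hNF : ∀ z : ℝ × ℝ, NF a b1 b3 c1 c3 b2 c2 (t • z) = (t ^ 2) •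
        ![z.1 ^ 2 - z.2 ^ 2, a * (z.1 ^ 2 + z.2 ^ 2) + t * F3 b1 b3 b2 t z,
        t * F3 c1 c3 c2 t z] := by
      intro z
      ext i
      fin_cases i <;> simp [NF, BC_eq] <;> ring
    have := heq' _ ht
    rw [hsQ, hNF, hNF, Matrix.mulVec_smul] at this
    exact smul_right_injective _ (pow_ne_zero 2 ht0) this
  have hid : Tendsto (fun t : ℝ => t) (𝓝[≠] 0) (𝓝 0) := tendsto_id.mono_left nhdsWithin_le_nhds
  have hquad : ∀ x y : ℝ, A.mulVec ![x ^ 2 - y ^ 2, a * (x ^ 2 + y ^ 2), 0] =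
      ![(α * x + β * y) ^ 2 - (γ * x + δ * y) ^ 2,
        a * ((α * x + β * y) ^ 2 + (γ * x + δ * y) ^ 2), 0] := by
    intro x y
    have hQ := ray_tendsto hL hs0 (x, y)
    have hsc := hscale (x, y)
    rw [hLxy] at hQ
    have key : ∀ (P : ℝ → ℝ × ℝ) (z : ℝ × ℝ), Tendsto P (𝓝[≠] 0) (𝓝 z) →
        Tendsto (fun t => ![(P t).1 ^ 2 - (P t).2 ^ 2,
          a * ((P t).1 ^ 2 + (P t).2 ^ 2) + t * F3 b1 b3 b2 t (P t),
          t * F3 c1 c3 c2 t (P t)]) (𝓝[≠] 0)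
          (𝓝 ![z.1 ^ 2 - z.2 ^ 2, a * (z.1 ^ 2 + z.2 ^ 2), 0]) := by
      intro P z hP
      have f1 : Tendsto (fun t => (P t).1) (𝓝[≠] 0) (𝓝 z.1) := (continuous_fst.tendsto z).comp hP
      have f2 : Tendsto (fun t => (P t).2) (𝓝[≠] 0) (𝓝 z.2) := (continuous_snd.tendsto z).comp hP
      have fb := hid.mul (F3_tendsto hb1.continuous hb3.continuous hb2.continuous hP)
      have fc := hid.mul (F3_tendsto hc1s.continuous hc3s.continuous hc2.continuous hP)
      rw [zero_mul] at fb fc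
      rw [tendsto_pi_nhds]
      intro i
      fin_cases i
      · simpa using (f1.pow 2).sub (f2.pow 2)
      · simpa using (((f1.pow 2).add (f2.pow 2)).const_mul a).add fb
      · simpa using fc
    have k1 := key (fun _ => (x, y)) (x, y) tendsto_const_nhds
    have k2 := key _ _ hQ
    have hmv : Continuous (fun w : Fin 3 → ℝ => A.mulVec w) := by fun_prop
    have k3 := (hmv.tendsto _).comp k1
    refine tendsto_nhds_unique k3 (k2.congr' ?_)
    filter_upwards [hsc] with t ht
    exact (ht _ rfl).symm
  have hcub : A 2 0 = 0 → A 2 1 = 0 → ∀ x y : ℝ, A 2 2 * (x ^ 3 * c1 0 + y ^ 3 * c3 0) =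
      (α * x + β * y) ^ 3 * c1 0 + (γ * x + δ * y) ^ 3 * c3 0 := by
    intro a20 a21 x y
    have hQ := ray_tendsto hL hs0 (x, y)
    have hsc := hscale (x, y)
    rw [hLxy] at hQ
    have k1 := F3_tendsto hc1s.continuous hc3s.continuous hc2.continuous
      (tendsto_const_nhds (x := ((x, y) : ℝ × ℝ)) (f := 𝓝[≠] (0:ℝ)))
    have k2 := F3_tendsto hc1s.continuous hc3s.continuous hc2.continuous hQ
    refine tendsto_nhds_unique (k1.const_mul (A 2 2)) (k2.congr' ?_)
    filter_upwards [hsc, self_mem_nhdsWithin] with t ht ht0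
    have ht0 : t ≠ 0 := ht0
    have := congrFun (ht _ rfl) 2
    simp only [Matrix.mulVec, dotProduct, Fin.sum_univ_three, a20, a21] at this
    simp at this
    apply mul_left_cancel₀ ht0
    simp only [Prod.smul_mk, smul_eq_mul] at this ⊢
    linear_combination -this
  obtain ⟨hA1, rfl, rfl, rfl, rfl⟩ := lin_case ha hc10 hc30 A hA hAdet hd hquad hcub
  refine ⟨hA1, ?_⟩
  have hLid : ∀ p, L p = p := by
    rintro ⟨x, y⟩
    rw [hLxy]; simp
  have hfix : ∀ p ∈ U, NF a b1 b3 c1 c3 b2 c2 (s p) = NF a b1 b3 c1 c3 b2 c2 p := by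
    intro p hp
    have := heq' p hp
    rw [hA1, Matrix.one_mulVec] at this
    exact this.symm
  obtain ⟨C, hC, ρ, hρ, HB⟩ := PP_BC hb1 hb3 hb2
  have hlit : ∀ᶠ p in 𝓝 (0 : ℝ × ℝ), ‖s p - p‖ ≤ 1 / 4 * ‖p‖ := by
    have := (hasFDerivAt_iff_isLittleO_nhds_zero.1 hL).def (by norm_num : (0:ℝ) < 1 / 4)
    simpa [hs0, hLid] using this
  obtain ⟨ε, hε, hball⟩ := Metric.mem_nhds_iff.1 (inter_mem hUn hlit)
  have hC1 : 0 < 4 * C + 1 := by positivity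
  refine flat_of_cone (ρ := min ε (min (ρ / 2) (a / 2 / (4 * C + 1)))) (hsm.sub contDiffAt_id)
    (by positivity) ?_
  rintro ⟨u, v⟩ hp hc1 hc2
  simp only at hc1 hc2
  have hp1 := lt_of_lt_of_le hp (min_le_left _ _)
  have hp2 := lt_of_lt_of_le hp ((min_le_right _ _).trans (min_le_left _ _))
  have hp3 := lt_of_lt_of_le hp ((min_le_right _ _).trans (min_le_right _ _))
  obtain ⟨hpU, hpl⟩ := hball (show (u, v) ∈ Metric.ball 0 ε by simpa using hp1)
  have hpl : ‖s (u, v) - (u, v)‖ ≤ 1 / 4 * ‖((u, v) : ℝ × ℝ)‖ := hpl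
  have hf := hfix _ hpU
  have hNdef : ‖((u, v) : ℝ × ℝ)‖ = max |u| |v| := rfl
  have hu0 : 0 < |u| := by linarith [abs_nonneg v]
  generalize hN : ‖((u, v) : ℝ × ℝ)‖ = N at *
  have hN0 : 0 < N := by rw [hNdef]; exact lt_max_of_lt_left hu0
  obtain ⟨u', v', hsp⟩ : ∃ u' v', s (u, v) = (u', v') := ⟨_, _, rfl⟩
  rw [hsp] at hpl hf
  have hDdef : ‖((u', v') : ℝ × ℝ) - (u, v)‖ = max |u' - u| |v' - v| := rfl
  have e1 := congrFun hf 0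
  have e2 := congrFun hf 1
  simp [NF] at e1 e2
  have hnorm' : ‖((u', v') : ℝ × ℝ)‖ ≤ 2 * N := by
    have := norm_add_le (((u', v') : ℝ × ℝ) - (u, v)) (u, v)
    rw [sub_add_cancel, hN] at this
    linarith
  have hBl := (HB (2 * N) (by positivity) (by linarith) (u', v') (u, v) hnorm'
    (by rw [hN]; linarith)).2
  have hz : ‖((u', v') : ℝ × ℝ) - (u, v)‖ = 0 := by
    refine cone_zero (C := 4 * C) (N := N) ha hN0 ?_ ?_ (by linarith) (hDdef ▸ le_max_left _ _)
      (hDdef ▸ le_max_right _ _) ?_ e1 e2 ?_ ?_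
    · rw [hNdef]; rcases max_choice |u| |v| with h | h <;> rw [h] <;> linarith
    · rw [hNdef]; rcases max_choice |u| |v| with h | h <;> rw [h] <;> linarith [abs_nonneg v]
    · rw [hDdef]; exact max_choice _ _
    · refine le_of_mul_le_mul_right (hBl.trans (le_of_eq ?_)) (by positivity : 0 < 2 * N)
      ring
    · rw [lt_div_iff₀ hC1] at hp3
      linarith
  rw [hsp]
  exact norm_eq_zero.1 hz
end
end

section
/- Fix the D₄⁺ normal form f with a > 0. Define φ₁(u,v) = (2, 2a + 3u b₁(u) + u² b₁′(u) + 2v² b₂(u,v) + u v² ∂ᵤb₂(u,v), 3u c₁(u) + u² c₁′(u) + 2v² c₂(u,v) + u v² ∂ᵤc₂(u,v)) and φ₂(u,v) = (−2, 2a + 3v b₃(v) + v² b₃′(v) + 2u² b₂(u,v) + u² v ∂ᵥb₂(u,v), 3v c₃(v) + v² c₃′(v) + 2u² c₂(u,v) + u² v ∂ᵥc₂(u,v)). Then ∂f/∂u(u,v) = u·φ₁(u,v) and ∂f/∂v(u,v) = v·φ₂(u,v) for all (u,v); φ₁(0,0) = (2, 2a, 0) and φ₂(0,0) = (−2, 2a,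 0) are linearly independent, and there is an open neighborhood U of the origin on which φ₁(u,v) and φ₂(u,v) are linearly independent at every point; consequently ν := (φ₁ × φ₂)/‖φ₁ × φ₂‖ is a C^∞ map U → ℝ³ with ‖ν‖ = 1, ⟨ν, ∂f/∂u⟩ = 0 and ⟨ν, ∂f/∂v⟩ = 0 on U (so f is a frontal near the origin). -/
open Real Filter Topology

noncomputable section

theorem aux_hd1 (g : ℝ × ℝ → ℝ) (hg : ContDiff ℝ (⊤ : ℕ∞) g) (p : ℝ × ℝ) :
    HasDerivAt (fun u => g (u, p.2)) (fderiv ℝ g p (1, 0)) p.1 := by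
  have h := (hg.differentiable (by simp) p).hasFDerivAt
  exact h.comp_hasDerivAt (f := fun u : ℝ => (u, p.2)) p.1
    ((hasDerivAt_id p.1).prodMk (hasDerivAt_const p.1 p.2))

theorem aux_hd2 (g : ℝ × ℝ → ℝ) (hg : ContDiff ℝ (⊤ : ℕ∞) g) (p : ℝ × ℝ) :
    HasDerivAt (fun v => g (p.1, v)) (fderiv ℝ g p (0, 1)) p.2 := by
  have h := (hg.differentiable (by simp) p).hasFDerivAt
  exact h.comp_hasDerivAt (f := fun v : ℝ => (p.1, v)) p.2
    ((hasDerivAt_const p.2 p.1).prodMk (hasDerivAt_id p.2))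

theorem aux_pd1 (g : ℝ × ℝ → ℝ) (hg : ContDiff ℝ (⊤ : ℕ∞) g) :
    ContDiff ℝ (⊤ : ℕ∞) (pd1 g) := by
  have : pd1 g = fun p => fderiv ℝ g p (1, 0) := funext fun p => (aux_hd1 g hg p).deriv
  rw [this]
  exact (hg.fderiv_right (by simp)).clm_apply contDiff_const

theorem aux_pd2 (g : ℝ × ℝ → ℝ) (hg : ContDiff ℝ (⊤ : ℕ∞) g) :
    ContDiff ℝ (⊤ : ℕ∞) (pd2 g) := by
  have : pd2 g = fun p => fderiv ℝ g p (0, 1) := funext fun p => (aux_hd2 g hg p).deriv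
  rw [this]
  exact (hg.fderiv_right (by simp)).clm_apply contDiff_const

theorem aux_deriv (g : ℝ → ℝ) (hg : ContDiff ℝ (⊤ : ℕ∞) g) :
    ContDiff ℝ (⊤ : ℕ∞) (deriv g) :=
  (contDiff_infty_iff_deriv.1 hg).2

theorem aux_hd1' (g : ℝ × ℝ → ℝ) (hg : ContDiff ℝ (⊤ : ℕ∞) g) (p : ℝ × ℝ) :
    HasDerivAt (fun u => g (u, p.2)) (pd1 g p) p.1 := by
  have := aux_hd1 g hg p
  rwa [show pd1 g p = _ from this.deriv]

theorem aux_hd2' (g : ℝ × ℝ → ℝ) (hg : ContDiff ℝ (⊤ : ℕ∞) g) (p : ℝ × ℝ) :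
    HasDerivAt (fun v => g (p.1, v)) (pd2 g p) p.2 := by
  have := aux_hd2 g hg p
  rwa [show pd2 g p = _ from this.deriv]

theorem aux_hd (g : ℝ → ℝ) (hg : ContDiff ℝ (⊤ : ℕ∞) g) (x : ℝ) :
    HasDerivAt g (deriv g x) x :=
  (hg.differentiable (by simp) x).hasDerivAt

theorem aux_BC1 (g1 g3 : ℝ → ℝ) (g2 : ℝ × ℝ → ℝ) (h1 : ContDiff ℝ (⊤ : ℕ∞) g1)
    (h2 : ContDiff ℝ (⊤ : ℕ∞) g2) (p : ℝ × ℝ) :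
    HasDerivAt (fun u => BC g1 g3 g2 (u, p.2)) (p.1 * (3 * p.1 * g1 p.1 + p.1 ^ 2 * deriv g1 p.1
      + 2 * p.2 ^ 2 * g2 p + p.1 * p.2 ^ 2 * pd1 g2 p)) p.1 := by
  have := ((((hasDerivAt_id p.1).pow 3).mul (aux_hd g1 h1 p.1)).add
    ((((hasDerivAt_id p.1).pow 2).mul_const (p.2 ^ 2)).mul (aux_hd1' g2 h2 p))).add_const
      (p.2 ^ 3 * g3 p.2)
  refine this.congr_deriv ?_
  simp
  ring

theorem aux_BC2 (g1 g3 : ℝ → ℝ) (g2 : ℝ × ℝ → ℝ) (h3 : ContDiff ℝ (⊤ : ℕ∞) g3)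
    (h2 : ContDiff ℝ (⊤ : ℕ∞) g2) (p : ℝ × ℝ) :
    HasDerivAt (fun v => BC g1 g3 g2 (p.1, v)) (p.2 * (3 * p.2 * g3 p.2 + p.2 ^ 2 * deriv g3 p.2
      + 2 * p.1 ^ 2 * g2 p + p.1 ^ 2 * p.2 * pd2 g2 p)) p.2 := by
  have := (((((hasDerivAt_id p.2).pow 2).const_mul (p.1 ^ 2)).mul (aux_hd2' g2 h2 p)).const_add
      (p.1 ^ 3 * g1 p.1)).add (((hasDerivAt_id p.2).pow 3).mul (aux_hd g3 h3 p.2))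
  refine this.congr_deriv ?_
  simp
  ring

theorem aux_li (x y : Fin 3 → ℝ) (h : x 0 * y 1 - x 1 * y 0 ≠ 0) :
    LinearIndependent ℝ ![x, y] := by
  rw [LinearIndependent.pair_iff]
  intro s t hst
  have h0 : s * x 0 + t * y 0 = 0 := by simpa using congrFun hst 0
  have h1 : s * x 1 + t * y 1 = 0 := by simpa using congrFun hst 1
  constructor
  · exact (mul_eq_zero.1 (show s * (x 0 * y 1 - x 1 * y 0) = 0 by
      linear_combination y 1 * h0 - y 0 * h1)).resolve_right h
  · exact (mul_eq_zero.1 (show t * (x 0 * y 1 - x 1 * y 0) = 0 by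
      linear_combination x 0 * h1 - x 1 * h0)).resolve_right h

theorem aux_dot_pos (x y : Fin 3 → ℝ) (h : x 0 * y 1 - x 1 * y 0 ≠ 0) :
    0 < dot3 (cross3 x y) (cross3 x y) := by
  have : 0 < (x 0 * y 1 - x 1 * y 0) ^ 2 := by positivity
  simp only [dot3, cross3, Matrix.cons_val]
  nlinarith [sq_nonneg (x 1 * y 2 - x 2 * y 1), sq_nonneg (x 2 * y 0 - x 0 * y 2)]

theorem aux_Phi1 (a : ℝ) (b1 c1 : ℝ → ℝ) (b2 c2 : ℝ × ℝ → ℝ)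
    (hb1 : ContDiff ℝ (⊤ : ℕ∞) b1) (hc1 : ContDiff ℝ (⊤ : ℕ∞) c1)
    (hb2 : ContDiff ℝ (⊤ : ℕ∞) b2) (hc2 : ContDiff ℝ (⊤ : ℕ∞) c2) :
    ContDiff ℝ (⊤ : ℕ∞) (Phi1 a b1 c1 b2 c2) := by
  have := aux_pd1 b2 hb2
  have := aux_pd1 c2 hc2
  have := aux_deriv b1 hb1
  have := aux_deriv c1 hc1
  rw [contDiff_pi]
  intro i
  fin_cases i <;> simp [Phi1] <;> fun_prop

theorem aux_Phi2 (a : ℝ) (b1 c1 : ℝ → ℝ) (b2 c2 : ℝ × ℝ → ℝ)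
    (hb1 : ContDiff ℝ (⊤ : ℕ∞) b1) (hc1 : ContDiff ℝ (⊤ : ℕ∞) c1)
    (hb2 : ContDiff ℝ (⊤ : ℕ∞) b2) (hc2 : ContDiff ℝ (⊤ : ℕ∞) c2) :
    ContDiff ℝ (⊤ : ℕ∞) (Phi2 a b1 c1 b2 c2) := by
  have := aux_pd2 b2 hb2
  have := aux_pd2 c2 hc2
  have := aux_deriv b1 hb1
  have := aux_deriv c1 hc1
  rw [contDiff_pi]
  intro i
  fin_cases i <;> simp [Phi2] <;> fun_prop

theorem aux_cross (x y : ℝ × ℝ → Fin 3 → ℝ) (hx : ContDiff ℝ (⊤ : ℕ∞) x)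
    (hy : ContDiff ℝ (⊤ : ℕ∞) y) : ContDiff ℝ (⊤ : ℕ∞) (fun p => cross3 (x p) (y p)) := by
  have hx' := contDiff_pi.1 hx
  have hy' := contDiff_pi.1 hy
  rw [contDiff_pi]
  intro i
  fin_cases i <;> simp [cross3] <;> fun_prop

/-- the normal form is a frontal near the origin, with unit normal
`ν = (φ₁ × φ₂)/‖φ₁ × φ₂‖`. -/
theorem stmt_3     (a : ℝ) (b1 b3 c1 c3 : ℝ → ℝ) (b2 c2 : ℝ × ℝ → ℝ)
    (hb1 : ContDiff ℝ (⊤ : ℕ∞) b1) (hb3 : ContDiff ℝ (⊤ : ℕ∞) b3)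
    (hc1s : ContDiff ℝ (⊤ : ℕ∞) c1) (hc3s : ContDiff ℝ (⊤ : ℕ∞) c3)
    (hb2 : ContDiff ℝ (⊤ : ℕ∞) b2) (hc2 : ContDiff ℝ (⊤ : ℕ∞) c2)
    (ha : 0 < a) :
    (∀ p : ℝ × ℝ, pd1 (NF a b1 b3 c1 c3 b2 c2) p = p.1 • Phi1 a b1 c1 b2 c2 p) ∧
    (∀ p : ℝ × ℝ, pd2 (NF a b1 b3 c1 c3 b2 c2) p = p.2 • Phi2 a b3 c3 b2 c2 p) ∧
    Phi1 a b1 c1 b2 c2 0 = ![2, 2 * a, 0] ∧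
    Phi2 a b3 c3 b2 c2 0 = ![-2, 2 * a, 0] ∧
    LinearIndependent ℝ ![Phi1 a b1 c1 b2 c2 0, Phi2 a b3 c3 b2 c2 0] ∧
    ∃ U : Set (ℝ × ℝ), IsOpen U ∧ (0 : ℝ × ℝ) ∈ U ∧
      (∀ p ∈ U, LinearIndependent ℝ ![Phi1 a b1 c1 b2 c2 p, Phi2 a b3 c3 b2 c2 p]) ∧
      ContDiffOn ℝ (⊤ : ℕ∞) (nuNF a b1 b3 c1 c3 b2 c2) U ∧
      ∀ p ∈ U, norm3 (nuNF a b1 b3 c1 c3 b2 c2 p) = 1 ∧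
        dot3 (nuNF a b1 b3 c1 c3 b2 c2 p) (pd1 (NF a b1 b3 c1 c3 b2 c2) p) = 0 ∧
        dot3 (nuNF a b1 b3 c1 c3 b2 c2 p) (pd2 (NF a b1 b3 c1 c3 b2 c2) p) = 0 := by
  have hP1 := aux_Phi1 a b1 c1 b2 c2 hb1 hc1s hb2 hc2
  have hP2 := aux_Phi2 a b3 c3 b2 c2 hb3 hc3s hb2 hc2
  have e1 : ∀ p : ℝ × ℝ, pd1 (NF a b1 b3 c1 c3 b2 c2) p = p.1 • Phi1 a b1 c1 b2 c2 p := by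
    intro p
    refine HasDerivAt.deriv ?_
    rw [hasDerivAt_pi]
    intro i
    fin_cases i
    · refine ((((hasDerivAt_id p.1).pow 2).sub_const (p.2 ^ 2)).congr_deriv ?_)
      simp [Phi1]; ring
    · refine (((((hasDerivAt_id p.1).pow 2).add_const (p.2 ^ 2)).const_mul a).add
        (aux_BC1 b1 b3 b2 hb1 hb2 p)).congr_deriv ?_
      simp [Phi1]; ring
    · exact (aux_BC1 c1 c3 c2 hc1s hc2 p).congr_deriv (by simp [Phi1])
  have e2 : ∀ p : ℝ × ℝ, pd2 (NF a b1 b3 c1 c3 b2 c2) p = p.2 • Phi2 a b3 c3 b2 c2 p := by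
    intro p
    refine HasDerivAt.deriv ?_
    rw [hasDerivAt_pi]
    intro i
    fin_cases i
    · refine ((((hasDerivAt_id p.2).pow 2).const_sub (p.1 ^ 2)).congr_deriv ?_)
      simp [Phi2]; ring
    · refine (((((hasDerivAt_id p.2).pow 2).const_add (p.1 ^ 2)).const_mul a).add
        (aux_BC2 b1 b3 b2 hb3 hb2 p)).congr_deriv ?_
      simp [Phi2]; ring
    · exact (aux_BC2 c1 c3 c2 hc3s hc2 p).congr_deriv (by simp [Phi2])
  have z1 : Phi1 a b1 c1 b2 c2 0 = ![2, 2 * a, 0] := by simp [Phi1]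
  have z2 : Phi2 a b3 c3 b2 c2 0 = ![-2, 2 * a, 0] := by simp [Phi2]
  have hd0 : Phi1 a b1 c1 b2 c2 0 0 * Phi2 a b3 c3 b2 c2 0 1
      - Phi1 a b1 c1 b2 c2 0 1 * Phi2 a b3 c3 b2 c2 0 0 ≠ 0 := by
    rw [z1, z2]
    simp only [Matrix.cons_val]
    nlinarith
  refine ⟨e1, e2, z1, z2, aux_li _ _ hd0,
    {p | Phi1 a b1 c1 b2 c2 p 0 * Phi2 a b3 c3 b2 c2 p 1
      - Phi1 a b1 c1 b2 c2 p 1 * Phi2 a b3 c3 b2 c2 p 0 ≠ 0}, ?_, hd0,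
    fun p hp => aux_li _ _ hp, ?_, ?_⟩
  · have h1 := continuous_pi_iff.1 hP1.continuous
    have h2 := continuous_pi_iff.1 hP2.continuous
    exact isOpen_ne_fun (by fun_prop) continuous_const
  · have hc := aux_cross _ _ hP1 hP2
    have hc' := contDiff_pi.1 hc
    intro p hp
    have hpos := aux_dot_pos _ _ hp
    have hn : ContDiffAt ℝ (⊤ : ℕ∞) (fun p => norm3 (cross3 (Phi1 a b1 c1 b2 c2 p)
        (Phi2 a b3 c3 b2 c2 p))) p := by
      refine ContDiffAt.sqrt ?_ hpos.ne'
      unfold dot3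
      exact ContDiff.contDiffAt (by fun_prop)
    exact ((hn.inv (Real.sqrt_pos.2 hpos).ne').smul hc.contDiffAt).contDiffWithinAt
  · intro p hp
    rw [e1, e2]
    have hpos := aux_dot_pos _ _ hp
    refine ⟨?_, ?_, ?_⟩
    · have hs := Real.sq_sqrt hpos.le
      have hs0 := (Real.sqrt_pos.2 hpos).ne'
      unfold nuNF
      generalize cross3 (Phi1 a b1 c1 b2 c2 p) (Phi2 a b3 c3 b2 c2 p) = w at *
      have : dot3 ((norm3 w)⁻¹ • w) ((norm3 w)⁻¹ • w) = 1 := by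
        have : dot3 ((norm3 w)⁻¹ • w) ((norm3 w)⁻¹ • w) = ((norm3 w)⁻¹) ^ 2 * dot3 w w := by
          simp [dot3]; ring
        rw [this, ← hs]
        unfold norm3
        field_simp
      rw [norm3, this, Real.sqrt_one]
    · simp only [nuNF, dot3, cross3, Pi.smul_apply, smul_eq_mul, Matrix.cons_val]
      ring
    · simp only [nuNF, dot3, cross3, Pi.smul_apply, smul_eq_mul, Matrix.cons_val]
      ring
end
end

section
/- Fix the D₄⁺ normal form f with a > 0 and let ν = (φ₁ × φ₂)/‖φ₁ × φ₂‖ be its unit normal near the origin. Then the partial derivatives ∂ν/∂u(0,0) and ∂ν/∂v(0,0) are linearly independent if and only if c₁(0)·c₃(0) ≠ 0 (i.e., f is a front at the origin exactly when c₁(0)c₃(0) ≠ 0). -/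
open Real Filter Topology

noncomputable section

theorem aux_nu (a : ℝ) (ha : 0 < a) (B1 C1 B2 C2 : ℝ → ℝ) (b c b' c' : ℝ)
    (hB1 : HasDerivAt B1 b 0) (hC1 : HasDerivAt C1 c 0)
    (hB2 : HasDerivAt B2 b' 0) (hC2 : HasDerivAt C2 c' 0)
    (h1 : B1 0 = 2 * a) (h2 : C1 0 = 0) (h3 : B2 0 = 2 * a) (h4 : C2 0 = 0) :
    deriv (fun t => (norm3 (cross3 ![2, B1 t, C1 t] ![-2, B2 t, C2 t]))⁻¹ •
      cross3 ![2, B1 t, C1 t] ![-2, B2 t, C2 t]) 0 =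
      ![(c' - c) / 4, -(c + c') / (4 * a), 0] := by
  have hx := (hB1.mul hC2).sub (hC1.mul hB2)
  have hy := (hC1.mul_const (-2)).sub (hC2.const_mul 2)
  have hz := (hB2.const_mul 2).sub (hB1.mul_const (-2))
  have hd := ((hx.mul hx).add (hy.mul hy)).add (hz.mul hz)
  have e8 : √(8 * a * (8 * a)) = 8 * a := Real.sqrt_mul_self (by positivity)
  have hn := (hd.sqrt (by
    simp only [Pi.add_apply, Pi.mul_apply, Pi.sub_apply, h1, h2, h3, h4]
    ring_nf; positivity)).inv (by
    simp only [Pi.add_apply, Pi.mul_apply, Pi.sub_apply, h1, h2, h3, h4]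
    ring_nf; positivity)
  apply HasDerivAt.deriv
  rw [hasDerivAt_pi]
  have es : √(a ^ 2 * 64) = 8 * a := by rw [← e8]; congr 1; ring
  intro i
  fin_cases i
  · refine (hn.mul hx).congr_deriv ?_
    simp [h1, h2, h3, h4]
    ring_nf
    rw [es]
    field_simp
    ring
  · refine (hn.mul hy).congr_deriv ?_
    simp [h1, h2, h3, h4]
    ring_nf
    rw [es]
    field_simp
    ring
  · refine (hn.mul hz).congr_deriv ?_
    simp [h1, h2, h3, h4]
    ring_nf
    rw [es]
    field_simp
    ring

theorem aux_q (k : ℝ) (g : ℝ → ℝ) (hg : ContDiff ℝ (⊤ : ℕ∞) g) :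
    HasDerivAt (fun u => k + 3 * u * g u + u ^ 2 * deriv g u) (3 * g 0) 0 := by
  have h1 : HasDerivAt g (deriv g 0) 0 :=
    (hg.differentiable (by simp)).differentiableAt.hasDerivAt
  have h2 : HasDerivAt (deriv g) (deriv (deriv g) 0) 0 := by
    have : ContDiff ℝ 1 (deriv g) := by
      have : ContDiff ℝ (1 + 1) g := hg.of_le (by norm_cast)
      exact (contDiff_succ_iff_deriv.1 this).2.2
    exact (this.differentiable (by simp)).differentiableAt.hasDerivAt
  refine (((((hasDerivAt_id' (0:ℝ)).const_mul 3).mul h1).const_add k).add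
    ((hasDerivAt_pow 2 (0:ℝ)).mul h2)).congr_deriv ?_
  simp

theorem aux_r (k : ℝ) (g : ℝ → ℝ) (hg : ContDiff ℝ (⊤ : ℕ∞) g) :
    HasDerivAt (fun u => k + 2 * u ^ 2 * g u) 0 0 := by
  have h1 : HasDerivAt g (deriv g 0) 0 :=
    (hg.differentiable (by simp)).differentiableAt.hasDerivAt
  refine ((((hasDerivAt_pow 2 (0:ℝ)).const_mul 2).mul h1).const_add k).congr_deriv ?_
  simp

/-- the normal form is a front at the origin iff `c₁(0)c₃(0) ≠ 0`. -/
theorem stmt_4     (a : ℝ) (b1 b3 c1 c3 : ℝ → ℝ) (b2 c2 : ℝ × ℝ → ℝ)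
    (hb1 : ContDiff ℝ (⊤ : ℕ∞) b1) (hb3 : ContDiff ℝ (⊤ : ℕ∞) b3)
    (hc1s : ContDiff ℝ (⊤ : ℕ∞) c1) (hc3s : ContDiff ℝ (⊤ : ℕ∞) c3)
    (hb2 : ContDiff ℝ (⊤ : ℕ∞) b2) (hc2 : ContDiff ℝ (⊤ : ℕ∞) c2)
    (ha : 0 < a) :
    LinearIndependent ℝ
        ![pd1 (nuNF a b1 b3 c1 c3 b2 c2) 0, pd2 (nuNF a b1 b3 c1 c3 b2 c2) 0] ↔
      c1 0 * c3 0 ≠ 0 := by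
  have hbu : ContDiff ℝ (⊤ : ℕ∞) (fun u : ℝ => b2 (u, 0)) := hb2.comp (by fun_prop)
  have hcu : ContDiff ℝ (⊤ : ℕ∞) (fun u : ℝ => c2 (u, 0)) := hc2.comp (by fun_prop)
  have hbv : ContDiff ℝ (⊤ : ℕ∞) (fun u : ℝ => b2 (0, u)) := hb2.comp (by fun_prop)
  have hcv : ContDiff ℝ (⊤ : ℕ∞) (fun u : ℝ => c2 (0, u)) := hc2.comp (by fun_prop)
  have e1 := aux_nu a ha _ _ _ _ _ _ _ _ (aux_q (2 * a) b1 hb1) (aux_q 0 c1 hc1s)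
    (aux_r (2 * a) _ hbu) (aux_r 0 _ hcu) (by simp) (by simp) (by simp) (by simp)
  have e2 := aux_nu a ha _ _ _ _ _ _ _ _ (aux_r (2 * a) _ hbv) (aux_r 0 _ hcv)
    (aux_q (2 * a) b3 hb3) (aux_q 0 c3 hc3s) (by simp) (by simp) (by simp) (by simp)
  have E1 : pd1 (nuNF a b1 b3 c1 c3 b2 c2) 0 = ![(0 - 3 * c1 0) / 4, -(3 * c1 0 + 0) / (4 * a), 0] := by
    rw [← e1]
    unfold pd1
    congr 1
    funext t
    simp [nuNF, Phi1, Phi2]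
  have E2 : pd2 (nuNF a b1 b3 c1 c3 b2 c2) 0 = ![(3 * c3 0 - 0) / 4, -(0 + 3 * c3 0) / (4 * a), 0] := by
    rw [← e2]
    unfold pd2
    congr 1
    funext t
    simp [nuNF, Phi1, Phi2]
  rw [E1, E2, LinearIndependent.pair_iff]
  constructor
  · intro h h0
    rcases mul_eq_zero.1 h0 with h0 | h0
    · have := h 1 0 (by ext i; fin_cases i <;> simp [h0])
      simp at this
    · have := h 0 1 (by ext i; fin_cases i <;> simp [h0])
      simp at this
  · intro h s t hst
    have hc1 := left_ne_zero_of_mul h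
    have hc3 := right_ne_zero_of_mul h
    have k0 := congrFun hst 0
    have k1 := congrFun hst 1
    simp at k0 k1
    field_simp at k0 k1
    have p1 : s * c1 0 = 0 := by linarith
    have p2 : t * c3 0 = 0 := by linarith
    exact ⟨(mul_eq_zero.1 p1).resolve_right hc1, (mul_eq_zero.1 p2).resolve_right hc3⟩
end
end

section
/- Fix the D₄⁺ normal form f with a > 0. There exists an open neighborhood U of the origin in ℝ² such that for every (u,v) ∈ U, the vectors ∂f/∂u(u,v) and ∂f/∂v(u,v) are linearly dependent if and only if uv = 0. In other words, near the origin the singular set of f is exactly the union of the two coordinate axes. -/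
open Real Filter Topology

noncomputable section

lemma pd1_hasDerivAt {g : ℝ × ℝ → ℝ} (hg : ContDiff ℝ (⊤ : ℕ∞) g) (p : ℝ × ℝ) :
    HasDerivAt (fun u => g (u, p.2)) (fderiv ℝ g p (1, 0)) p.1 := by
  have h : HasFDerivAt g (fderiv ℝ g p) (p.1, p.2) :=
    (hg.differentiable (by simp) p).hasFDerivAt
  exact h.comp_hasDerivAt p.1 ((hasDerivAt_id p.1).prodMk (hasDerivAt_const p.1 p.2))

lemma pd2_hasDerivAt {g : ℝ × ℝ → ℝ} (hg : ContDiff ℝ (⊤ : ℕ∞) g) (p : ℝ × ℝ) :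
    HasDerivAt (fun v => g (p.1, v)) (fderiv ℝ g p (0, 1)) p.2 := by
  have h : HasFDerivAt g (fderiv ℝ g p) (p.1, p.2) :=
    (hg.differentiable (by simp) p).hasFDerivAt
  exact h.comp_hasDerivAt p.2 ((hasDerivAt_const p.2 p.1).prodMk (hasDerivAt_id p.2))

lemma pd1_continuous {g : ℝ × ℝ → ℝ} (hg : ContDiff ℝ (⊤ : ℕ∞) g) : Continuous (pd1 g) := by
  have : pd1 g = fun p => fderiv ℝ g p (1, 0) := funext fun p => (pd1_hasDerivAt hg p).deriv
  rw [this]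
  exact (hg.continuous_fderiv (by simp)).clm_apply continuous_const

lemma pd2_continuous {g : ℝ × ℝ → ℝ} (hg : ContDiff ℝ (⊤ : ℕ∞) g) : Continuous (pd2 g) := by
  have : pd2 g = fun p => fderiv ℝ g p (0, 1) := funext fun p => (pd2_hasDerivAt hg p).deriv
  rw [this]
  exact (hg.continuous_fderiv (by simp)).clm_apply continuous_const

lemma BC_pd1 {g1 g3 : ℝ → ℝ} {g2 : ℝ × ℝ → ℝ} (h1 : ContDiff ℝ (⊤ : ℕ∞) g1)
    (h2 : ContDiff ℝ (⊤ : ℕ∞) g2) (p : ℝ × ℝ) :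
    HasDerivAt (fun u => BC g1 g3 g2 (u, p.2))
      (p.1 * (3 * p.1 * g1 p.1 + p.1 ^ 2 * deriv g1 p.1 + 2 * p.2 ^ 2 * g2 p +
      p.1 * p.2 ^ 2 * pd1 g2 p)) p.1 := by
  have e1 := (h1.differentiable (by simp) p.1).hasDerivAt
  have e2 := pd1_hasDerivAt h2 p
  have e3 : pd1 g2 p = _ := e2.deriv
  rw [← e3] at e2
  have := ((((hasDerivAt_id p.1).pow 3).mul e1).add
    ((((hasDerivAt_id p.1).pow 2).mul_const (p.2 ^ 2)).mul e2)).add_const (p.2 ^ 3 * g3 p.2)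
  refine this.congr_deriv ?_
  simp
  ring

lemma BC_pd2 {g1 g3 : ℝ → ℝ} {g2 : ℝ × ℝ → ℝ} (h3 : ContDiff ℝ (⊤ : ℕ∞) g3)
    (h2 : ContDiff ℝ (⊤ : ℕ∞) g2) (p : ℝ × ℝ) :
    HasDerivAt (fun v => BC g1 g3 g2 (p.1, v))
      (p.2 * (3 * p.2 * g3 p.2 + p.2 ^ 2 * deriv g3 p.2 + 2 * p.1 ^ 2 * g2 p +
      p.1 ^ 2 * p.2 * pd2 g2 p)) p.2 := by
  have e1 := (h3.differentiable (by simp) p.2).hasDerivAt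
  have e2 := pd2_hasDerivAt h2 p
  have e3 : pd2 g2 p = _ := e2.deriv
  rw [← e3] at e2
  have := ((((((hasDerivAt_id p.2).pow 2).const_mul (p.1 ^ 2)).mul e2)).const_add
    (p.1 ^ 3 * g1 p.1)).add (((hasDerivAt_id p.2).pow 3).mul e1)
  refine this.congr_deriv ?_
  simp
  ring

/-- near the origin the singular set of the normal form is `{uv = 0}`. -/
theorem stmt_5     (a : ℝ) (b1 b3 c1 c3 : ℝ → ℝ) (b2 c2 : ℝ × ℝ → ℝ)
    (hb1 : ContDiff ℝ (⊤ : ℕ∞) b1) (hb3 : ContDiff ℝ (⊤ : ℕ∞) b3)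
    (hc1s : ContDiff ℝ (⊤ : ℕ∞) c1) (hc3s : ContDiff ℝ (⊤ : ℕ∞) c3)
    (hb2 : ContDiff ℝ (⊤ : ℕ∞) b2) (hc2 : ContDiff ℝ (⊤ : ℕ∞) c2)
    (ha : 0 < a) :
    ∃ U : Set (ℝ × ℝ), IsOpen U ∧ (0 : ℝ × ℝ) ∈ U ∧
      ∀ p ∈ U,
        (¬ LinearIndependent ℝ
            ![pd1 (NF a b1 b3 c1 c3 b2 c2) p, pd2 (NF a b1 b3 c1 c3 b2 c2) p]) ↔
          p.1 * p.2 = 0 := by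
  have hD1 : ∀ p, pd1 (NF a b1 b3 c1 c3 b2 c2) p = p.1 • Phi1 a b1 c1 b2 c2 p := by
    intro p
    refine HasDerivAt.deriv (hasDerivAt_pi.2 fun i => ?_)
    fin_cases i
    · refine (((hasDerivAt_id p.1).pow 2).sub_const (p.2 ^ 2)).congr_deriv ?_
      simp [Phi1]
      ring
    · refine (((((hasDerivAt_id p.1).pow 2).add_const (p.2 ^ 2)).const_mul a).add
        (BC_pd1 (g3 := b3) hb1 hb2 p)).congr_deriv ?_
      simp [Phi1]
      ring
    · refine (BC_pd1 (g3 := c3) hc1s hc2 p).congr_deriv ?_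
      simp [Phi1]
  have hD2 : ∀ p, pd2 (NF a b1 b3 c1 c3 b2 c2) p = p.2 • Phi2 a b3 c3 b2 c2 p := by
    intro p
    refine HasDerivAt.deriv (hasDerivAt_pi.2 fun i => ?_)
    fin_cases i
    · refine (((hasDerivAt_id p.2).pow 2).const_sub (p.1 ^ 2)).congr_deriv ?_
      simp [Phi2]
      ring
    · refine (((((hasDerivAt_id p.2).pow 2).const_add (p.1 ^ 2)).const_mul a).add
        (BC_pd2 (g1 := b1) hb3 hb2 p)).congr_deriv ?_
      simp [Phi2]
      ring
    · refine (BC_pd2 (g1 := c1) hc3s hc2 p).congr_deriv ?_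
      simp [Phi2]
  refine ⟨{p | 0 < Phi1 a b1 c1 b2 c2 p 1 + Phi2 a b3 c3 b2 c2 p 1}, ?_, ?_, ?_⟩
  · refine isOpen_lt continuous_const ?_
    have k1 := hb1.continuous
    have k2 := hb2.continuous
    have k3 := hb3.continuous
    have k4 := hb1.continuous_deriv (by simp)
    have k5 := hb3.continuous_deriv (by simp)
    have k6 := pd1_continuous hb2
    have k7 := pd2_continuous hb2
    simp only [Phi1, Phi2, Matrix.cons_val_one, Matrix.cons_val_zero]
    fun_prop
  · simp [Phi1, Phi2]
    linarith
  · intro p hp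
    have hp' : 0 < Phi1 a b1 c1 b2 c2 p 1 + Phi2 a b3 c3 b2 c2 p 1 := hp
    rw [hD1, hD2, ← not_iff_not, not_not, LinearIndependent.pair_iff]
    constructor
    · intro h h0
      rcases mul_eq_zero.1 h0 with h0 | h0
      · simpa using (h 1 0 (by simp [h0])).1
      · simpa using (h 0 1 (by simp [h0])).2
    · intro h s t hst
      have q0 := congrFun hst 0
      have q1 := congrFun hst 1
      have z1 : Phi1 a b1 c1 b2 c2 p 0 = 2 := rfl
      have z2 : Phi2 a b3 c3 b2 c2 p 0 = -2 := rfl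
      simp only [Pi.add_apply, Pi.smul_apply, smul_eq_mul, Pi.zero_apply, z1, z2] at q0 q1
      generalize Phi1 a b1 c1 b2 c2 p 1 = P at *
      generalize Phi2 a b3 c3 b2 c2 p 1 = Q at *
      have hu : p.1 ≠ 0 := left_ne_zero_of_mul h
      have hv : p.2 ≠ 0 := right_ne_zero_of_mul h
      have e : s * p.1 = t * p.2 := by linarith
      have e2 : (s * p.1) * (P + Q) = 0 := by linear_combination q1 + Q * e
      have e3 : s * p.1 = 0 := (mul_eq_zero.1 e2).resolve_right hp'.ne'
      exact ⟨(mul_eq_zero.1 e3).resolve_right hu,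
        (mul_eq_zero.1 (e ▸ e3)).resolve_right hv⟩
end
end

section
/- Fix the D₄⁺ normal form f with a > 0, with unit normal ν near the origin, and let K = (LN − M²)/(EG − F²) be the Gaussian curvature of f, defined near the origin where uv ≠ 0. Then lim_{(u,v)→(0,0), uv≠0} u·v·K(u,v) = 9·c₁(0)·c₃(0)/(64a²). In particular, if c₁(0)c₃(0) ≠ 0 then K is unbounded near the origin. -/
open Real Filter Topology

noncomputable section

/-- The Gaussian curvature `K = (LN − M²)/(EG − F²)` of the D₄⁺ normal form. -/
def Kg (a : ℝ) (b1 b3 c1 c3 : ℝ → ℝ) (b2 c2 : ℝ × ℝ → ℝ) (p : ℝ × ℝ) : ℝ :=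
  (dot3 (pd1 (pd1 (NF a b1 b3 c1 c3 b2 c2)) p) (nuNF a b1 b3 c1 c3 b2 c2 p) *
      dot3 (pd2 (pd2 (NF a b1 b3 c1 c3 b2 c2)) p) (nuNF a b1 b3 c1 c3 b2 c2 p) -
    dot3 (pd2 (pd1 (NF a b1 b3 c1 c3 b2 c2)) p) (nuNF a b1 b3 c1 c3 b2 c2 p) ^ 2) /
  (dot3 (pd1 (NF a b1 b3 c1 c3 b2 c2) p) (pd1 (NF a b1 b3 c1 c3 b2 c2) p) *
      dot3 (pd2 (NF a b1 b3 c1 c3 b2 c2) p) (pd2 (NF a b1 b3 c1 c3 b2 c2) p) -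
    dot3 (pd1 (NF a b1 b3 c1 c3 b2 c2) p) (pd2 (NF a b1 b3 c1 c3 b2 c2) p) ^ 2)

lemma aux_h1 {g : ℝ × ℝ → ℝ} (hg : ContDiff ℝ (⊤ : ℕ∞) g) (u v : ℝ) :
    HasDerivAt (fun u => g (u, v)) (fderiv ℝ g (u, v) (1, 0)) u := by
  have h := ((hg.differentiable (by simp)) (u, v)).hasFDerivAt
  exact h.comp_hasDerivAt u ((hasDerivAt_id u).prodMk (hasDerivAt_const u v))

lemma aux_h2 {g : ℝ × ℝ → ℝ} (hg : ContDiff ℝ (⊤ : ℕ∞) g) (u v : ℝ) :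
    HasDerivAt (fun v => g (u, v)) (fderiv ℝ g (u, v) (0, 1)) v := by
  have h := ((hg.differentiable (by simp)) (u, v)).hasFDerivAt
  exact h.comp_hasDerivAt v ((hasDerivAt_const v u).prodMk (hasDerivAt_id v))

lemma aux_d1 {g : ℝ × ℝ → ℝ} (hg : ContDiff ℝ (⊤ : ℕ∞) g) (u v : ℝ) :
    HasDerivAt (fun u => g (u, v)) (pd1 g (u, v)) u := by
  have h := aux_h1 hg u v
  unfold pd1
  exact h.differentiableAt.hasDerivAt

lemma aux_d2 {g : ℝ × ℝ → ℝ} (hg : ContDiff ℝ (⊤ : ℕ∞) g) (u v : ℝ) :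
    HasDerivAt (fun v => g (u, v)) (pd2 g (u, v)) v := by
  have h := aux_h2 hg u v
  unfold pd2
  exact h.differentiableAt.hasDerivAt

lemma aux_s1 {g : ℝ × ℝ → ℝ} (hg : ContDiff ℝ (⊤ : ℕ∞) g) :
    ContDiff ℝ (⊤ : ℕ∞) (pd1 g) := by
  have : pd1 g = fun p => fderiv ℝ g p (1, 0) := by
    funext p
    exact (aux_h1 hg p.1 p.2).deriv
  rw [this]
  exact (hg.fderiv_right (by simp)).clm_apply contDiff_const

lemma aux_s2 {g : ℝ × ℝ → ℝ} (hg : ContDiff ℝ (⊤ : ℕ∞) g) :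
    ContDiff ℝ (⊤ : ℕ∞) (pd2 g) := by
  have : pd2 g = fun p => fderiv ℝ g p (0, 1) := by
    funext p
    exact (aux_h2 hg p.1 p.2).deriv
  rw [this]
  exact (hg.fderiv_right (by simp)).clm_apply contDiff_const

lemma aux_s {g : ℝ → ℝ} (hg : ContDiff ℝ (⊤ : ℕ∞) g) : ContDiff ℝ (⊤ : ℕ∞) (deriv g) :=
  ContDiff.iterate_deriv 1 hg

lemma aux_d {g : ℝ → ℝ} (hg : ContDiff ℝ (⊤ : ℕ∞) g) (u : ℝ) : HasDerivAt g (deriv g u) u :=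
  ((hg.differentiable (by simp)) u).hasDerivAt

def P1 (g1 : ℝ → ℝ) (g2 : ℝ × ℝ → ℝ) (p : ℝ × ℝ) : ℝ :=
  3 * p.1 * g1 p.1 + p.1 ^ 2 * deriv g1 p.1 + 2 * p.2 ^ 2 * g2 p + p.1 * p.2 ^ 2 * pd1 g2 p

def P2 (g3 : ℝ → ℝ) (g2 : ℝ × ℝ → ℝ) (p : ℝ × ℝ) : ℝ :=
  3 * p.2 * g3 p.2 + p.2 ^ 2 * deriv g3 p.2 + 2 * p.1 ^ 2 * g2 p + p.1 ^ 2 * p.2 * pd2 g2 p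

def Q1 (g1 : ℝ → ℝ) (g2 : ℝ × ℝ → ℝ) (p : ℝ × ℝ) : ℝ :=
  3 * g1 p.1 + 5 * p.1 * deriv g1 p.1 + p.1 ^ 2 * deriv (deriv g1) p.1
    + 3 * p.2 ^ 2 * pd1 g2 p + p.1 * p.2 ^ 2 * pd1 (pd1 g2) p

def Q2 (g3 : ℝ → ℝ) (g2 : ℝ × ℝ → ℝ) (p : ℝ × ℝ) : ℝ :=
  3 * g3 p.2 + 5 * p.2 * deriv g3 p.2 + p.2 ^ 2 * deriv (deriv g3) p.2
    + 3 * p.1 ^ 2 * pd2 g2 p + p.1 ^ 2 * p.2 * pd2 (pd2 g2) p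

def R1 (g2 : ℝ × ℝ → ℝ) (p : ℝ × ℝ) : ℝ :=
  4 * g2 p + 2 * p.2 * pd2 g2 p + 2 * p.1 * pd1 g2 p + p.1 * p.2 * pd2 (pd1 g2) p

lemma BC_d1 {g1 g3 : ℝ → ℝ} {g2 : ℝ × ℝ → ℝ} (h1 : ContDiff ℝ (⊤ : ℕ∞) g1)
    (h2 : ContDiff ℝ (⊤ : ℕ∞) g2) (u v : ℝ) :
    HasDerivAt (fun u => BC g1 g3 g2 (u, v)) (u * P1 g1 g2 (u, v)) u := by
  have h := ((((hasDerivAt_id u).pow 3).mul (aux_d h1 u)).add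
    ((((hasDerivAt_id u).pow 2).mul_const (v ^ 2)).mul (aux_d1 h2 u v))).add_const (v ^ 3 * g3 v)
  refine HasDerivAt.congr_deriv (f := fun u => BC g1 g3 g2 (u, v)) h ?_
  simp [P1]; ring

lemma BC_d2 {g1 g3 : ℝ → ℝ} {g2 : ℝ × ℝ → ℝ} (h3 : ContDiff ℝ (⊤ : ℕ∞) g3)
    (h2 : ContDiff ℝ (⊤ : ℕ∞) g2) (u v : ℝ) :
    HasDerivAt (fun v => BC g1 g3 g2 (u, v)) (v * P2 g3 g2 (u, v)) v := by
  have h := (((((hasDerivAt_id v).pow 2).const_mul (u ^ 2)).mul (aux_d2 h2 u v)).const_add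
    (u ^ 3 * g1 u)).add (((hasDerivAt_id v).pow 3).mul (aux_d h3 v))
  refine HasDerivAt.congr_deriv (f := fun v => BC g1 g3 g2 (u, v)) h ?_
  simp [P2]; ring

lemma P1_d1 {g1 : ℝ → ℝ} {g2 : ℝ × ℝ → ℝ} (h1 : ContDiff ℝ (⊤ : ℕ∞) g1)
    (h2 : ContDiff ℝ (⊤ : ℕ∞) g2) (u v : ℝ) :
    HasDerivAt (fun u => P1 g1 g2 (u, v)) (Q1 g1 g2 (u, v)) u := by
  have h := (((((hasDerivAt_id u).const_mul 3).mul (aux_d h1 u)).add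
    (((hasDerivAt_id u).pow 2).mul (aux_d (aux_s h1) u))).add
    ((aux_d1 h2 u v).const_mul (2 * v ^ 2))).add
    (((hasDerivAt_id u).mul_const (v ^ 2)).mul (aux_d1 (aux_s1 h2) u v))
  refine HasDerivAt.congr_deriv (f := fun u => P1 g1 g2 (u, v)) h ?_
  simp [Q1]; ring

lemma P1_d2 {g1 : ℝ → ℝ} {g2 : ℝ × ℝ → ℝ}
    (h2 : ContDiff ℝ (⊤ : ℕ∞) g2) (u v : ℝ) :
    HasDerivAt (fun v => P1 g1 g2 (u, v)) (v * R1 g2 (u, v)) v := by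
  have h := (((((hasDerivAt_id v).pow 2).const_mul 2).mul (aux_d2 h2 u v)).const_add
    (3 * u * g1 u + u ^ 2 * deriv g1 u)).add
    ((((hasDerivAt_id v).pow 2).const_mul u).mul (aux_d2 (aux_s1 h2) u v))
  refine HasDerivAt.congr_deriv (f := fun v => P1 g1 g2 (u, v)) h ?_
  simp [R1]; ring

lemma P2_d2 {g3 : ℝ → ℝ} {g2 : ℝ × ℝ → ℝ} (h3 : ContDiff ℝ (⊤ : ℕ∞) g3)
    (h2 : ContDiff ℝ (⊤ : ℕ∞) g2) (u v : ℝ) :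
    HasDerivAt (fun v => P2 g3 g2 (u, v)) (Q2 g3 g2 (u, v)) v := by
  have h := (((((hasDerivAt_id v).const_mul 3).mul (aux_d h3 v)).add
    (((hasDerivAt_id v).pow 2).mul (aux_d (aux_s h3) v))).add
    ((aux_d2 h2 u v).const_mul (2 * u ^ 2))).add
    (((hasDerivAt_id v).const_mul (u ^ 2)).mul (aux_d2 (aux_s2 h2) u v))
  refine HasDerivAt.congr_deriv (f := fun v => P2 g3 g2 (u, v)) h ?_
  simp [Q2]; ring

lemma P1_c {g1 : ℝ → ℝ} {g2 : ℝ × ℝ → ℝ} (h1 : ContDiff ℝ (⊤ : ℕ∞) g1)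
    (h2 : ContDiff ℝ (⊤ : ℕ∞) g2) : Continuous (P1 g1 g2) := by
  have := h1.continuous; have := h2.continuous
  have := (aux_s h1).continuous; have := (aux_s1 h2).continuous
  unfold P1; fun_prop

lemma P2_c {g1 : ℝ → ℝ} {g2 : ℝ × ℝ → ℝ} (h1 : ContDiff ℝ (⊤ : ℕ∞) g1)
    (h2 : ContDiff ℝ (⊤ : ℕ∞) g2) : Continuous (P2 g1 g2) := by
  have := h1.continuous; have := h2.continuous
  have := (aux_s h1).continuous; have := (aux_s2 h2).continuous
  unfold P2; fun_prop

lemma Q1_c {g1 : ℝ → ℝ} {g2 : ℝ × ℝ → ℝ} (h1 : ContDiff ℝ (⊤ : ℕ∞) g1)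
    (h2 : ContDiff ℝ (⊤ : ℕ∞) g2) : Continuous (Q1 g1 g2) := by
  have := h1.continuous
  have := (aux_s h1).continuous; have := (aux_s1 h2).continuous
  have := (aux_s (aux_s h1)).continuous; have := (aux_s1 (aux_s1 h2)).continuous
  unfold Q1; fun_prop

lemma Q2_c {g1 : ℝ → ℝ} {g2 : ℝ × ℝ → ℝ} (h1 : ContDiff ℝ (⊤ : ℕ∞) g1)
    (h2 : ContDiff ℝ (⊤ : ℕ∞) g2) : Continuous (Q2 g1 g2) := by
  have := h1.continuous
  have := (aux_s h1).continuous; have := (aux_s2 h2).continuous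
  have := (aux_s (aux_s h1)).continuous; have := (aux_s2 (aux_s2 h2)).continuous
  unfold Q2; fun_prop

lemma R1_c {g2 : ℝ × ℝ → ℝ}
    (h2 : ContDiff ℝ (⊤ : ℕ∞) g2) : Continuous (R1 g2) := by
  have := h2.continuous
  have := (aux_s2 h2).continuous; have := (aux_s1 h2).continuous
  have := (aux_s2 (aux_s1 h2)).continuous
  unfold R1; fun_prop

lemma vec_d {f g h : ℝ → ℝ} {f' g' h' x : ℝ} (hf : HasDerivAt f f' x) (hg : HasDerivAt g g' x)
    (hh : HasDerivAt h h' x) :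
    deriv (fun t => (![f t, g t, h t] : Fin 3 → ℝ)) x = ![f', g', h'] := by
  apply HasDerivAt.deriv
  rw [hasDerivAt_pi]
  intro i
  fin_cases i
  · exact hf
  · exact hg
  · exact hh

section
variable {a : ℝ} {b1 b3 c1 c3 : ℝ → ℝ} {b2 c2 : ℝ × ℝ → ℝ}
    (hb1 : ContDiff ℝ (⊤ : ℕ∞) b1) (hb3 : ContDiff ℝ (⊤ : ℕ∞) b3)
    (hc1 : ContDiff ℝ (⊤ : ℕ∞) c1) (hc3 : ContDiff ℝ (⊤ : ℕ∞) c3)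
    (hb2 : ContDiff ℝ (⊤ : ℕ∞) b2) (hc2 : ContDiff ℝ (⊤ : ℕ∞) c2)

lemma Phi1_eq : Phi1 a b1 c1 b2 c2 = fun p => ![2, 2 * a + P1 b1 b2 p, P1 c1 c2 p] := by
  funext p; unfold Phi1 P1; congr 2; ring

lemma Phi2_eq : Phi2 a b3 c3 b2 c2 = fun p => ![-2, 2 * a + P2 b3 b2 p, P2 c3 c2 p] := by
  funext p; unfold Phi2 P2; congr 2; ring

lemma NF_1 (hb1 : ContDiff ℝ (⊤ : ℕ∞) b1) (hc1 : ContDiff ℝ (⊤ : ℕ∞) c1)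
    (hb2 : ContDiff ℝ (⊤ : ℕ∞) b2) (hc2 : ContDiff ℝ (⊤ : ℕ∞) c2) :
    pd1 (NF a b1 b3 c1 c3 b2 c2) =
    fun p => ![p.1 * 2, p.1 * (2 * a + P1 b1 b2 p), p.1 * P1 c1 c2 p] := by
  funext p
  obtain ⟨u, v⟩ := p
  have h1 : HasDerivAt (fun u : ℝ => u ^ 2 - v ^ 2) (u * 2) u :=
    ((hasDerivAt_pow 2 u).sub_const (v ^ 2)).congr_deriv (by simp; ring)
  have h2 : HasDerivAt (fun u : ℝ => a * (u ^ 2 + v ^ 2) + BC b1 b3 b2 (u, v))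
      (u * (2 * a + P1 b1 b2 (u, v))) u :=
    ((((hasDerivAt_pow 2 u).add_const (v ^ 2)).const_mul a).add
      (BC_d1 hb1 hb2 u v)).congr_deriv (by simp; ring)
  exact vec_d h1 h2 (BC_d1 hc1 hc2 u v)

lemma NF_2 (hb3 : ContDiff ℝ (⊤ : ℕ∞) b3) (hc3 : ContDiff ℝ (⊤ : ℕ∞) c3)
    (hb2 : ContDiff ℝ (⊤ : ℕ∞) b2) (hc2 : ContDiff ℝ (⊤ : ℕ∞) c2) :
    pd2 (NF a b1 b3 c1 c3 b2 c2) =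
    fun p => ![p.2 * (-2), p.2 * (2 * a + P2 b3 b2 p), p.2 * P2 c3 c2 p] := by
  funext p
  obtain ⟨u, v⟩ := p
  have h1 : HasDerivAt (fun v : ℝ => u ^ 2 - v ^ 2) (v * (-2)) v :=
    ((hasDerivAt_pow 2 v).const_sub (u ^ 2)).congr_deriv (by simp; ring)
  have h2 : HasDerivAt (fun v : ℝ => a * (u ^ 2 + v ^ 2) + BC b1 b3 b2 (u, v))
      (v * (2 * a + P2 b3 b2 (u, v))) v :=
    ((((hasDerivAt_pow 2 v).const_add (u ^ 2)).const_mul a).add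
      (BC_d2 hb3 hb2 u v)).congr_deriv (by simp; ring)
  exact vec_d h1 h2 (BC_d2 hc3 hc2 u v)

lemma NF_11 (hb1 : ContDiff ℝ (⊤ : ℕ∞) b1) (hc1 : ContDiff ℝ (⊤ : ℕ∞) c1)
    (hb2 : ContDiff ℝ (⊤ : ℕ∞) b2) (hc2 : ContDiff ℝ (⊤ : ℕ∞) c2) (p : ℝ × ℝ) :
    pd1 (pd1 (NF a b1 b3 c1 c3 b2 c2)) p =
    ![2, 2 * a + P1 b1 b2 p + p.1 * Q1 b1 b2 p, P1 c1 c2 p + p.1 * Q1 c1 c2 p] := by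
  rw [NF_1 hb1 hc1 hb2 hc2]
  obtain ⟨u, v⟩ := p
  refine vec_d (((hasDerivAt_id u).mul_const 2).congr_deriv (by simp))
    (((hasDerivAt_id u).mul ((P1_d1 hb1 hb2 u v).const_add (2 * a))).congr_deriv (by simp))
    (((hasDerivAt_id u).mul (P1_d1 hc1 hc2 u v)).congr_deriv (by simp))

lemma NF_12 (hb1 : ContDiff ℝ (⊤ : ℕ∞) b1) (hc1 : ContDiff ℝ (⊤ : ℕ∞) c1)
    (hb2 : ContDiff ℝ (⊤ : ℕ∞) b2) (hc2 : ContDiff ℝ (⊤ : ℕ∞) c2) (p : ℝ × ℝ) :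
    pd2 (pd1 (NF a b1 b3 c1 c3 b2 c2)) p =
    ![0, p.1 * (p.2 * R1 b2 p), p.1 * (p.2 * R1 c2 p)] := by
  rw [NF_1 hb1 hc1 hb2 hc2]
  obtain ⟨u, v⟩ := p
  exact vec_d (hasDerivAt_const v (u * 2))
    (((P1_d2 hb2 u v).const_add (2 * a)).const_mul u)
    ((P1_d2 hc2 u v).const_mul u)

lemma NF_22 (hb3 : ContDiff ℝ (⊤ : ℕ∞) b3) (hc3 : ContDiff ℝ (⊤ : ℕ∞) c3)
    (hb2 : ContDiff ℝ (⊤ : ℕ∞) b2) (hc2 : ContDiff ℝ (⊤ : ℕ∞) c2) (p : ℝ × ℝ) :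
    pd2 (pd2 (NF a b1 b3 c1 c3 b2 c2)) p =
    ![-2, 2 * a + P2 b3 b2 p + p.2 * Q2 b3 b2 p, P2 c3 c2 p + p.2 * Q2 c3 c2 p] := by
  rw [NF_2 hb3 hc3 hb2 hc2]
  obtain ⟨u, v⟩ := p
  refine vec_d (((hasDerivAt_id v).mul_const (-2)).congr_deriv (by simp))
    (((hasDerivAt_id v).mul ((P2_d2 hb3 hb2 u v).const_add (2 * a))).congr_deriv (by simp))
    (((hasDerivAt_id v).mul (P2_d2 hc3 hc2 u v)).congr_deriv (by simp))

end

lemma alg {u v x1 x2 y1 y2 A1 A2 B1 B2 C1 C2 n0 n1 n2 W : ℝ} (hu : u ≠ 0) (hv : v ≠ 0)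
    (e0 : n0 = x1 * y2 - x2 * y1) (e1 : n1 = x2 * (-2) - 2 * y2) (e2 : n2 = 2 * y1 - x1 * (-2))
    (hW : W = n0 * n0 + n1 * n1 + n2 * n2) (hW0 : W ≠ 0) (s : ℝ) (hs : s ^ 2 = W) :
    u * v * (((2 * (s⁻¹ * n0) + (x1 + u * A1) * (s⁻¹ * n1) + (x2 + u * A2) * (s⁻¹ * n2)) *
      (-2 * (s⁻¹ * n0) + (y1 + v * B1) * (s⁻¹ * n1) + (y2 + v * B2) * (s⁻¹ * n2)) -
      (0 * (s⁻¹ * n0) + (u * (v * C1)) * (s⁻¹ * n1) + (u * (v * C2)) * (s⁻¹ * n2)) ^ 2) /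
      ((u * 2 * (u * 2) + u * x1 * (u * x1) + u * x2 * (u * x2)) *
       (v * (-2) * (v * (-2)) + v * y1 * (v * y1) + v * y2 * (v * y2)) -
       (u * 2 * (v * (-2)) + u * x1 * (v * y1) + u * x2 * (v * y2)) ^ 2)) =
    ((A1 * n1 + A2 * n2) * (B1 * n1 + B2 * n2) - u * v * (C1 * n1 + C2 * n2) ^ 2) / W ^ 2 := by
  have hD : ((u * 2 * (u * 2) + u * x1 * (u * x1) + u * x2 * (u * x2)) *
       (v * (-2) * (v * (-2)) + v * y1 * (v * y1) + v * y2 * (v * y2)) -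
       (u * 2 * (v * (-2)) + u * x1 * (v * y1) + u * x2 * (v * y2)) ^ 2) = u ^ 2 * v ^ 2 * W := by
    rw [hW, e0, e1, e2]; ring
  have hL : 2 * (s⁻¹ * n0) + (x1 + u * A1) * (s⁻¹ * n1) + (x2 + u * A2) * (s⁻¹ * n2)
      = s⁻¹ * (u * (A1 * n1 + A2 * n2)) := by
    rw [e0, e1, e2]; ring
  have hN : -2 * (s⁻¹ * n0) + (y1 + v * B1) * (s⁻¹ * n1) + (y2 + v * B2) * (s⁻¹ * n2)
      = s⁻¹ * (v * (B1 * n1 + B2 * n2)) := by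
    rw [e0, e1, e2]; ring
  have hM : 0 * (s⁻¹ * n0) + (u * (v * C1)) * (s⁻¹ * n1) + (u * (v * C2)) * (s⁻¹ * n2)
      = s⁻¹ * (u * v * (C1 * n1 + C2 * n2)) := by ring
  have hs0 : s ≠ 0 := by rintro rfl; apply hW0; rw [← hs]; simp
  rw [hD, hL, hN, hM, ← hs]
  field_simp

/-- behaviour of the Gaussian curvature at the `D₄⁺`-singularity. -/
theorem stmt_6     (a : ℝ) (b1 b3 c1 c3 : ℝ → ℝ) (b2 c2 : ℝ × ℝ → ℝ)
    (hb1 : ContDiff ℝ (⊤ : ℕ∞) b1) (hb3 : ContDiff ℝ (⊤ : ℕ∞) b3)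
    (hc1s : ContDiff ℝ (⊤ : ℕ∞) c1) (hc3s : ContDiff ℝ (⊤ : ℕ∞) c3)
    (hb2 : ContDiff ℝ (⊤ : ℕ∞) b2) (hc2 : ContDiff ℝ (⊤ : ℕ∞) c2)
    (ha : 0 < a) :
    Filter.Tendsto (fun p : ℝ × ℝ => p.1 * p.2 * Kg a b1 b3 c1 c3 b2 c2 p)
      (𝓝[{p : ℝ × ℝ | p.1 * p.2 ≠ 0}] 0) (𝓝 (9 * c1 0 * c3 0 / (64 * a ^ 2))) ∧
    (c1 0 * c3 0 ≠ 0 → ∀ M : ℝ, ∀ ε > (0 : ℝ), ∃ p : ℝ × ℝ,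
      ‖p‖ < ε ∧ p.1 * p.2 ≠ 0 ∧ M < |Kg a b1 b3 c1 c3 b2 c2 p|) := by
  have hP1b := P1_c hb1 hb2
  have hP1c := P1_c hc1s hc2
  have hP2b := P2_c hb3 hb2
  have hP2c := P2_c hc3s hc2
  have hQ1b := Q1_c hb1 hb2
  have hQ1c := Q1_c hc1s hc2
  have hQ2b := Q2_c hb3 hb2
  have hQ2c := Q2_c hc3s hc2
  have hRb := R1_c hb2
  have hRc := R1_c hc2
  obtain ⟨n0, hn0⟩ : ∃ n : ℝ × ℝ → ℝ, n = fun p => (2 * a + P1 b1 b2 p) * P2 c3 c2 p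
    - P1 c1 c2 p * (2 * a + P2 b3 b2 p) := ⟨_, rfl⟩
  obtain ⟨n1, hn1⟩ : ∃ n : ℝ × ℝ → ℝ, n = fun p => P1 c1 c2 p * (-2) - 2 * P2 c3 c2 p := ⟨_, rfl⟩
  obtain ⟨n2, hn2⟩ : ∃ n : ℝ × ℝ → ℝ, n = fun p => 2 * (2 * a + P2 b3 b2 p)
    - (2 * a + P1 b1 b2 p) * (-2) := ⟨_, rfl⟩
  obtain ⟨W, hW⟩ : ∃ W : ℝ × ℝ → ℝ, W = fun p => n0 p * n0 p + n1 p * n1 p + n2 p * n2 p :=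
    ⟨_, rfl⟩
  have hn0c : Continuous n0 := by rw [hn0]; fun_prop
  have hn1c : Continuous n1 := by rw [hn1]; fun_prop
  have hn2c : Continuous n2 := by rw [hn2]; fun_prop
  have hWc : Continuous W := by rw [hW]; fun_prop
  have z0 : n0 0 = 0 := by simp [hn0, P1, P2]
  have z1 : n1 0 = 0 := by simp [hn1, P1, P2]
  have z2 : n2 0 = 8 * a := by simp [hn2, P1, P2]; ring
  have zW : W 0 = 64 * a ^ 2 := by simp [hW, z0, z1, z2]; ring
  have hW0 : W 0 ≠ 0 := by rw [zW]; positivity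
  obtain ⟨H, hH⟩ : ∃ H : ℝ × ℝ → ℝ, H = fun p =>
    ((Q1 b1 b2 p * n1 p + Q1 c1 c2 p * n2 p) * (Q2 b3 b2 p * n1 p + Q2 c3 c2 p * n2 p)
      - p.1 * p.2 * (R1 b2 p * n1 p + R1 c2 p * n2 p) ^ 2) / W p ^ 2 := ⟨_, rfl⟩
  have hHc : ContinuousAt H 0 := by
    rw [hH]
    apply ContinuousAt.div
    · fun_prop
    · fun_prop
    · exact pow_ne_zero 2 hW0
  have zH : H 0 = 9 * c1 0 * c3 0 / (64 * a ^ 2) := by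
    simp [hH, z1, z2, zW, Q1, Q2]
    field_simp
    ring
  have key : ∀ p : ℝ × ℝ, p.1 * p.2 ≠ 0 → W p ≠ 0 →
      p.1 * p.2 * Kg a b1 b3 c1 c3 b2 c2 p = H p := by
    intro p hp hWp
    have hpos : 0 ≤ W p := by
      rw [hW]
      exact add_nonneg (add_nonneg (mul_self_nonneg _) (mul_self_nonneg _)) (mul_self_nonneg _)
    have hA := alg (A1 := Q1 b1 b2 p) (A2 := Q1 c1 c2 p) (B1 := Q2 b3 b2 p) (B2 := Q2 c3 c2 p)
      (C1 := R1 b2 p) (C2 := R1 c2 p)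
      (left_ne_zero_of_mul hp) (right_ne_zero_of_mul hp) (congrFun hn0 p) (congrFun hn1 p)
      (congrFun hn2 p) (congrFun hW p) hWp _ (Real.sq_sqrt hpos)
    have hnu : nuNF a b1 b3 c1 c3 b2 c2 p = ![(√(W p))⁻¹ * n0 p, (√(W p))⁻¹ * n1 p,
        (√(W p))⁻¹ * n2 p] := by
      have hcr : cross3 (Phi1 a b1 c1 b2 c2 p) (Phi2 a b3 c3 b2 c2 p) = ![n0 p, n1 p, n2 p] := by
        rw [Phi1_eq, Phi2_eq, hn0, hn1, hn2]; rfl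
      have hno : norm3 ![n0 p, n1 p, n2 p] = √(W p) := by rw [hW]; rfl
      unfold nuNF
      rw [hcr, hno]
      simp
    rw [hH]
    refine Eq.trans ?_ hA
    unfold Kg
    rw [hnu, NF_11 hb1 hc1s hb2 hc2, NF_12 hb1 hc1s hb2 hc2, NF_22 hb3 hc3s hb2 hc2,
      NF_1 hb1 hc1s hb2 hc2, NF_2 hb3 hc3s hb2 hc2]
    rfl
  have hlim : Filter.Tendsto (fun p : ℝ × ℝ => p.1 * p.2 * Kg a b1 b3 c1 c3 b2 c2 p)
      (𝓝[{p : ℝ × ℝ | p.1 * p.2 ≠ 0}] 0) (𝓝 (9 * c1 0 * c3 0 / (64 * a ^ 2))) := by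
    rw [← zH]
    refine (hHc.tendsto.mono_left nhdsWithin_le_nhds).congr' ?_
    filter_upwards [self_mem_nhdsWithin,
      nhdsWithin_le_nhds (hWc.continuousAt.eventually_ne hW0)] with p hp hWp
    exact (key p hp hWp).symm
  refine ⟨hlim, fun hc M ε hε => ?_⟩
  by_contra! hcon
  have hne : (𝓝[{p : ℝ × ℝ | p.1 * p.2 ≠ 0}] (0 : ℝ × ℝ)).NeBot := by
    rw [← mem_closure_iff_nhdsWithin_neBot, Metric.mem_closure_iff]
    intro δ hδ
    refine ⟨(δ / 2, δ / 2), ?_, ?_⟩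
    · have : δ / 2 ≠ 0 := by positivity
      exact mul_ne_zero this this
    · rw [dist_zero_left, Prod.norm_def]
      simp [abs_of_pos hδ, hδ]
  have h0 : Filter.Tendsto (fun p : ℝ × ℝ => p.1 * p.2 * Kg a b1 b3 c1 c3 b2 c2 p)
      (𝓝[{p : ℝ × ℝ | p.1 * p.2 ≠ 0}] 0) (𝓝 0) := by
    have hb : Filter.Tendsto (fun p : ℝ × ℝ => |p.1 * p.2| * M)
        (𝓝[{p : ℝ × ℝ | p.1 * p.2 ≠ 0}] 0) (𝓝 0) := by
      have : Continuous (fun p : ℝ × ℝ => |p.1 * p.2| * M) := by fun_prop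
      exact (this.tendsto' 0 0 (by simp)).mono_left nhdsWithin_le_nhds
    refine squeeze_zero_norm' ?_ hb
    filter_upwards [self_mem_nhdsWithin,
      nhdsWithin_le_nhds (Metric.ball_mem_nhds (0 : ℝ × ℝ) hε)] with p hp hpb
    rw [Real.norm_eq_abs, abs_mul]
    exact mul_le_mul_of_nonneg_left (hcon p (by simpa using hpb) hp) (abs_nonneg _)
  have := tendsto_nhds_unique hlim h0
  have h9 : 9 * c1 0 * c3 0 / (64 * a ^ 2) ≠ 0 := by
    rw [mul_assoc]
    exact div_ne_zero (mul_ne_zero (by norm_num) hc) (by positivity)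
  exact h9 this
end
end
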